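/- arXiv:2006.02611 — 4 statements merged into one kernel-verified Lean document; each statement's English description precedes it below -/
import Mathlib

section
/- Let G be a random d₁ × n real matrix and H a random d₂ × n real matrix defined on a common probability space, such that G and H are independent, each is a centered Gaussian matrix, and E[(uᵀ vec(G))²] ≤ σ² for every unit vector u ∈ ℝ^{d₁n} and E[(vᵀ vec(H))²] ≤ σ² for every unit vector v ∈ ℝ^{d₂n}. Then for every x ≥ 0, with probability at least 1 − 2e^{−x²/2}, ‖G Hᵀ‖_S ≤ σ²(√(d₁d₂) + √(d₁n) + √(d₂n)) + σ² x (x + 2√n + √d₁ + √d₂). -/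
open Matrix MeasureTheory ProbabilityTheory

/-- Spectral norm (largest singular value) of a real matrix, as the operator norm of the
associated linear map between Euclidean spaces. -/
noncomputable def specNorm {m n : Type*} [Fintype m] [Fintype n] [DecidableEq n]
    (A : Matrix m n ℝ) : ℝ :=
  ‖LinearMap.toContinuousLinearMap (Matrix.toEuclideanLin A)‖

/-- A random vector is a centered Gaussian vector when every linear functional of it has a
centered real Gaussian distribution. -/
def IsCenteredGaussianVec {Ω ι : Type*} [MeasurableSpace Ω] [Fintype ι]
    (μ : Measure Ω) (X : Ω → ι → ℝ) : Prop :=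
  ∀ u : ι → ℝ, ∃ v : NNReal,
    Measure.map (fun ω => ∑ i, u i * X ω i) μ = gaussianReal 0 v

/-- At most exponential growth in the norm. -/
def ExpGrowth {E F : Type*} [NormedAddCommGroup E] [NormedAddCommGroup F] (f : E → F) : Prop :=
  ∃ C : ℝ, 0 ≤ C ∧ ∀ x, ‖f x‖ ≤ Real.exp (C * (1 + ‖x‖))

namespace ExpGrowth

variable {E F G : Type*} [NormedAddCommGroup E] [NormedAddCommGroup F] [NormedAddCommGroup G]

lemma of_linear_bound {f : E → F} {K : ℝ} (hK : 0 ≤ K) (h : ∀ x, ‖f x‖ ≤ K * (1 + ‖x‖)) :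
    ExpGrowth f := by
  refine ⟨K, hK, fun x ↦ (h x).trans ?_⟩
  linarith [Real.add_one_le_exp (K * (1 + ‖x‖))]

lemma of_bound {f : E → F} {K : ℝ} (h : ∀ x, ‖f x‖ ≤ K) : ExpGrowth f := by
  have hK : 0 ≤ K := (norm_nonneg _).trans (h 0)
  refine of_linear_bound hK fun x ↦ (h x).trans ?_
  nlinarith [norm_nonneg x]

lemma const (c : F) : ExpGrowth (fun _ : E ↦ c) := of_bound (K := ‖c‖) fun _ ↦ le_rfl

lemma of_le {f : E → F} {g : E → G} (hg : ExpGrowth g) (h : ∀ x, ‖f x‖ ≤ ‖g x‖) :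
    ExpGrowth f := by
  obtain ⟨C, hC, hb⟩ := hg
  exact ⟨C, hC, fun x ↦ (h x).trans (hb x)⟩

lemma norm {f : E → F} (hf : ExpGrowth f) : ExpGrowth (fun x ↦ ‖f x‖) :=
  hf.of_le fun x ↦ by simp

lemma mul {f g : E → ℝ} (hf : ExpGrowth f) (hg : ExpGrowth g) :
    ExpGrowth (fun x ↦ f x * g x) := by
  obtain ⟨C, hC, hf⟩ := hf
  obtain ⟨D, hD, hg⟩ := hg
  refine ⟨C + D, by positivity, fun x ↦ ?_⟩
  rw [norm_mul, add_mul, Real.exp_add]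
  exact mul_le_mul (hf x) (hg x) (norm_nonneg _) (Real.exp_nonneg _)

lemma add {f g : E → F} (hf : ExpGrowth f) (hg : ExpGrowth g) :
    ExpGrowth (fun x ↦ f x + g x) := by
  obtain ⟨C, hC, hf⟩ := hf
  obtain ⟨D, hD, hg⟩ := hg
  refine ⟨C + D + 1, by positivity, fun x ↦ (norm_add_le _ _).trans ?_⟩
  have hx := norm_nonneg x
  have h1 : Real.exp (C * (1 + ‖x‖)) ≤ Real.exp ((C + D) * (1 + ‖x‖)) :=
    Real.exp_le_exp.2 (by nlinarith [mul_nonneg hD (by positivity : 0 ≤ 1 + ‖x‖)])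
  have h2 : Real.exp (D * (1 + ‖x‖)) ≤ Real.exp ((C + D) * (1 + ‖x‖)) :=
    Real.exp_le_exp.2 (by nlinarith [mul_nonneg hC (by positivity : 0 ≤ 1 + ‖x‖)])
  have h3 : 2 ≤ Real.exp (1 + ‖x‖) := by linarith [Real.add_one_le_exp (1 + ‖x‖)]
  have h4 : Real.exp ((C + D + 1) * (1 + ‖x‖))
      = Real.exp ((C + D) * (1 + ‖x‖)) * Real.exp (1 + ‖x‖) := by
    rw [← Real.exp_add]; ring_nf
  rw [h4]
  nlinarith [hf x, hg x, Real.exp_pos ((C + D) * (1 + ‖x‖))]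

lemma sum {ι : Type*} (s : Finset ι) {f : ι → E → F} (hf : ∀ i ∈ s, ExpGrowth (f i)) :
    ExpGrowth (fun x ↦ ∑ i ∈ s, f i x) := by
  classical
  induction s using Finset.induction_on with
  | empty => simpa using const (0 : F)
  | insert a s ha ih =>
    simp_rw [Finset.sum_insert ha]
    exact (hf a (by simp)).add (ih fun i hi ↦ hf i (by simp [hi]))

lemma comp {f : F → G} {g : E → F} (hf : ExpGrowth f) {K : ℝ} (hK : 0 ≤ K)
    (hg : ∀ x, ‖g x‖ ≤ K * (1 + ‖x‖)) : ExpGrowth (fun x ↦ f (g x)) := by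
  obtain ⟨C, hC, hf⟩ := hf
  refine ⟨C * (1 + K), by positivity, fun x ↦ (hf _).trans (Real.exp_le_exp.2 ?_)⟩
  rw [mul_assoc]
  refine mul_le_mul_of_nonneg_left ?_ hC
  nlinarith [hg x, norm_nonneg x]

lemma clm [NormedSpace ℝ E] [NormedSpace ℝ F] (L : E →L[ℝ] F) : ExpGrowth (fun x ↦ L x) := by
  refine of_linear_bound (norm_nonneg L) fun x ↦ (L.le_opNorm x).trans ?_
  nlinarith [norm_nonneg L, norm_nonneg x]

lemma comp_clm [NormedSpace ℝ E] [NormedSpace ℝ F] {f : F → G} (hf : ExpGrowth f)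
    (L : E →L[ℝ] F) : ExpGrowth (fun x ↦ f (L x)) := by
  refine hf.comp (norm_nonneg L) fun x ↦ (L.le_opNorm x).trans ?_
  nlinarith [norm_nonneg L, norm_nonneg x]

lemma clm_apply [NormedSpace ℝ F] [NormedSpace ℝ G] {f : E → F →L[ℝ] G} (hf : ExpGrowth f)
    (c : F) : ExpGrowth (fun x ↦ f x c) := by
  refine of_le (hf.norm.mul (const ‖c‖)) fun x ↦ ((f x).le_opNorm c).trans ?_
  simp

end ExpGrowth

section Gaussian

variable {E : Type*} [NormedAddCommGroup E] [NormedSpace ℝ E] [MeasurableSpace E] [BorelSpace E]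
  [SecondCountableTopology E] [CompleteSpace E]

lemma integrable_exp_mul_norm (μ : Measure E) [IsGaussian μ] (C : ℝ) :
    Integrable (fun x ↦ Real.exp (C * (1 + ‖x‖))) μ := by
  obtain ⟨a, ha, hint⟩ := IsGaussian.exists_integrable_exp_sq μ
  refine (hint.const_mul (Real.exp (C + C ^ 2 / (4 * a)))).mono'
    (by fun_prop) (ae_of_all _ fun x ↦ ?_)
  rw [Real.norm_eq_abs, Real.abs_exp, ← Real.exp_add, Real.exp_le_exp]
  have : C ^ 2 / (4 * a) + a * ‖x‖ ^ 2 - C * ‖x‖ = (C - 2 * a * ‖x‖) ^ 2 / (4 * a) := by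
    field_simp; ring
  nlinarith [show 0 ≤ (C - 2 * a * ‖x‖) ^ 2 / (4 * a) by positivity]

lemma ExpGrowth.integrable {F : Type*} [NormedAddCommGroup F] {f : E → F} (hf : ExpGrowth f)
    (μ : Measure E) [IsGaussian μ] (hc : AEStronglyMeasurable f μ) : Integrable f μ := by
  obtain ⟨C, -, hb⟩ := hf
  exact (integrable_exp_mul_norm μ C).mono' hc (ae_of_all _ hb)

/-- Stein's identity. -/
lemma integral_id_mul_gaussianReal {v : NNReal} (hv : v ≠ 0) {k k' : ℝ → ℝ}
    (hk : ∀ t, HasDerivAt k (k' t) t) (hk'c : Continuous k') (hg : ExpGrowth k)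
    (hg' : ExpGrowth k') :
    ∫ t, t * k t ∂(gaussianReal 0 v) = v * ∫ t, k' t ∂(gaussianReal 0 v) := by
  have hkc : Continuous k := continuous_iff_continuousAt.2 fun t ↦ (hk t).continuousAt
  have hint : ∀ f : ℝ → ℝ, Continuous f → ExpGrowth f →
      Integrable (fun t ↦ gaussianPDFReal 0 v t * f t) := by
    intro f hfc hf
    have := hf.integrable (gaussianReal 0 v) hfc.aestronglyMeasurable
    rw [gaussianReal_of_var_ne_zero _ hv, integrable_withDensity_iff_integrable_smul'
      (measurable_gaussianPDF _ _) (ae_of_all _ fun _ ↦ gaussianPDF_lt_top)] at this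
    simpa using this
  have hid : ExpGrowth (fun t : ℝ ↦ t) := ExpGrowth.clm (ContinuousLinearMap.id ℝ ℝ)
  have hv' : (v : ℝ) ≠ 0 := by exact_mod_cast hv
  have hpdf : ∀ t, HasDerivAt (gaussianPDFReal 0 v) (-(t / v) * gaussianPDFReal 0 v t) t := by
    intro t
    rw [gaussianPDFReal_def]
    have h1 : HasDerivAt (fun x : ℝ ↦ -(x - 0) ^ 2 / (2 * (v : ℝ))) (-(t / v)) t := by
      have := ((((hasDerivAt_id t).sub_const 0).pow 2).neg).div_const (2 * (v : ℝ))
      convert! this using 1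
      simp; field_simp
    have := (h1.exp).const_mul (√(2 * Real.pi * v))⁻¹
    convert! this using 1
    ring
  have key := integral_mul_deriv_eq_deriv_mul_of_integrable (u := k) (v := gaussianPDFReal 0 v)
    (u' := k') (v' := fun t ↦ -(t / v) * gaussianPDFReal 0 v t) (fun t _ ↦ hk t)
    (fun t _ ↦ hpdf t)
    (by
      have := (hint _ (continuous_id.mul hkc) (hid.mul hg)).const_mul (-(v : ℝ)⁻¹)
      refine this.congr (ae_of_all _ fun t ↦ ?_)
      simp only [Pi.mul_apply, id]; field_simp)
    (by
      refine (hint _ hk'c hg').congr (ae_of_all _ fun t ↦ ?_)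
      simp only [Pi.mul_apply]; ring)
    (by
      refine (hint _ hkc hg).congr (ae_of_all _ fun t ↦ ?_)
      simp only [Pi.mul_apply]; ring)
  rw [integral_gaussianReal_eq_integral_smul hv, integral_gaussianReal_eq_integral_smul hv]
  calc ∫ t, gaussianPDFReal 0 v t • (t * k t)
      = ∫ t, -(v : ℝ) * (k t * (-(t / v) * gaussianPDFReal 0 v t)) := by
        congr 1; ext t; simp only [smul_eq_mul]; field_simp
    _ = v * ∫ t, gaussianPDFReal 0 v t • k' t := by
        rw [integral_const_mul, key]
        simp only [smul_eq_mul, mul_neg, neg_mul, neg_neg]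
        congr 2; ext t; ring

/-- Gaussian integration by parts. -/
theorem integral_dual_mul_eq_integral_fderiv (μ : Measure E) [IsGaussian μ]
    (hμ : ∀ L : StrongDual ℝ E, ∫ x, L x ∂μ = 0) (l : StrongDual ℝ E) (c : E)
    (hc : ∀ L : StrongDual ℝ E, ∫ x, l x * L x ∂μ = L c) {h : E → ℝ} (hd : ContDiff ℝ 1 h)
    (hg : ExpGrowth h) (hg' : ExpGrowth (fderiv ℝ h)) :
    ∫ x, l x * h x ∂μ = ∫ x, fderiv ℝ h x c ∂μ := by
  have hL2 : ∀ L : StrongDual ℝ E, MemLp L 2 μ := fun L ↦ IsGaussian.memLp_dual μ L 2 (by simp)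
  by_cases hv : Var[l; μ] = 0
  · have hl : l =ᵐ[μ] 0 := by
      filter_upwards [ae_eq_integral_of_variance_eq_zero (hL2 l) hv] with x hx
      rw [hx, hμ l]; rfl
    have hc0 : c = 0 := by
      refine SeparatingDual.eq_zero_of_forall_dual_eq_zero (R := ℝ) fun L ↦ ?_
      rw [← hc L]
      refine integral_eq_zero_of_ae ?_
      filter_upwards [hl] with x hx
      simp [hx]
    simp only [hc0, map_zero, integral_zero]
    refine integral_eq_zero_of_ae ?_
    filter_upwards [hl] with x hx
    simp [hx]
  · have hvpos : 0 < Var[l; μ] := lt_of_le_of_ne (variance_nonneg _ _) (Ne.symm hv)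
    set v := Var[l; μ] with hvdef
    set d : E := v⁻¹ • c with hddef
    have hlc : l c = v := by
      rw [← hc l, hvdef, variance_eq_sub (hL2 l), hμ l]
      simp [pow_two]
    set R : E →L[ℝ] E := ContinuousLinearMap.id ℝ E - l.smulRight d with hR
    have hRx : ∀ x, R x = x - l x • d := fun x ↦ by simp [hR]
    have hJ : HasGaussianLaw (fun x ↦ (l x, R x)) μ :=
      (IsGaussian.hasGaussianLaw_id (μ := μ)).map (l.prod R)
    have hind : IndepFun (fun x ↦ l x) (fun x ↦ R x) μ := by
      refine hJ.indepFun_of_covariance_strongDual fun L₁ L₂ ↦ ?_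
      have e1 : (L₁ ∘ fun x ↦ l x) = (L₁ ∘L l : StrongDual ℝ E) := rfl
      have e2 : (L₂ ∘ fun x ↦ R x) = (L₂ ∘L R : StrongDual ℝ E) := rfl
      rw [e1, e2, covariance_eq_sub (hL2 _) (hL2 _), hμ, hμ, mul_zero, sub_zero]
      have : ∀ x, ((L₁ ∘L l : StrongDual ℝ E) * (L₂ ∘L R : StrongDual ℝ E) : E → ℝ) x
          = L₁ 1 * (l x * (L₂ ∘L R : StrongDual ℝ E) x) := by
        intro x
        have : L₁ (l x) = l x * L₁ 1 := by
          rw [← smul_eq_mul, ← map_smul]; simp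
        simp [this]; ring
      simp_rw [this]
      rw [integral_const_mul, hc]
      simp [hRx, hlc, hddef, hvpos.ne']
    have hprod := (indepFun_iff_map_prod_eq_prod_map_map (by fun_prop) (by fun_prop)).1 hind
    have hlmap : μ.map (fun x ↦ l x) = gaussianReal 0 v.toNNReal := by
      have := IsGaussian.map_eq_gaussianReal (μ := μ) l
      rwa [hμ l] at this
    have hvn : v.toNNReal ≠ 0 := by simpa using hvpos
    have hRg : IsGaussian (μ.map (fun x ↦ R x)) := isGaussian_map (μ := μ) R
    rw [hlmap] at hprod
    set ν := μ.map (fun x ↦ R x)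
    have hhc : Continuous h := hd.continuous
    have hh'c : Continuous (fderiv ℝ h) := hd.continuous_fderiv one_ne_zero
    set T : ℝ × E →L[ℝ] E :=
      ContinuousLinearMap.snd ℝ ℝ E + (ContinuousLinearMap.fst ℝ ℝ E).smulRight d with hT
    have hTx : ∀ p, T p = p.2 + p.1 • d := fun p ↦ by simp [hT]
    have hfwd : ∀ g : ℝ × E → ℝ, Continuous g → ExpGrowth g →
        ∫ x, g (l x, R x) ∂μ = ∫ r, ∫ t, g (t, r) ∂(gaussianReal 0 v.toNNReal) ∂ν := by
      intro g hgc hg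
      rw [← integral_map (φ := fun x ↦ (l x, R x)) (f := g) (by fun_prop)
        hgc.aestronglyMeasurable, hprod, integral_prod_symm]
      exact hg.integrable _ hgc.aestronglyMeasurable
    have hTR : ∀ x, T (l x, R x) = x := fun x ↦ by rw [hTx, hRx]; simp
    have h1 := hfwd (fun p ↦ p.1 * h (T p)) (by fun_prop)
      ((ExpGrowth.clm (ContinuousLinearMap.fst ℝ ℝ E)).mul (hg.comp_clm T))
    have h2 := hfwd (fun p ↦ fderiv ℝ h (T p) c) (by fun_prop) ((hg'.comp_clm T).clm_apply c)
    simp only [hTR] at h1 h2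
    rw [h1, h2]
    congr 1
    ext r
    have hb : ∀ t : ℝ, ‖T (t, r)‖ ≤ (‖r‖ + ‖d‖) * (1 + ‖t‖) := by
      intro t
      rw [hTx]
      refine (norm_add_le _ _).trans ?_
      rw [norm_smul]
      nlinarith [norm_nonneg r, norm_nonneg d, norm_nonneg t,
        mul_nonneg (norm_nonneg r) (norm_nonneg t)]
    have hst := integral_id_mul_gaussianReal hvn (k := fun t ↦ h (T (t, r)))
      (k' := fun t ↦ fderiv ℝ h (T (t, r)) d)
      (fun t ↦ by
        have h1 : HasDerivAt (fun t : ℝ ↦ T (t, r)) d t := by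
          simp only [hTx]
          simpa using ((hasDerivAt_id t).smul_const d).const_add r
        exact ((hd.differentiable one_ne_zero) _).hasFDerivAt.comp_hasDerivAt t h1)
      (by fun_prop) (hg.comp (by positivity) hb)
      ((hg'.clm_apply d).comp (by positivity) hb)
    rw [hst, Real.coe_toNNReal _ hvpos.le, ← integral_const_mul]
    congr 1
    ext t
    rw [hddef, map_smul, smul_eq_mul, ← mul_assoc, mul_inv_cancel₀ hvpos.ne', one_mul]

end Gaussian

section Interpolation

variable {ι : Type*} [Fintype ι]

/-- A row of the (uncentered) covariance matrix of a measure on `ι → ℝ`. -/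
noncomputable def covRow (μ : Measure (ι → ℝ)) (i : ι) : ι → ℝ := ∫ x, x i • x ∂μ

lemma integrable_eval_smul_self (μ : Measure (ι → ℝ)) [IsGaussian μ] (i : ι) :
    Integrable (fun x : ι → ℝ ↦ x i • x) μ := by
  refine ExpGrowth.integrable (ExpGrowth.of_le
    ((ExpGrowth.clm (ContinuousLinearMap.proj (R := ℝ) (φ := fun _ : ι ↦ ℝ) i)).mul
      (ExpGrowth.clm (ContinuousLinearMap.id ℝ (ι → ℝ))).norm) fun x ↦ ?_) μ
    (Continuous.aestronglyMeasurable (by fun_prop))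
  simp [norm_smul]

lemma dual_covRow (μ : Measure (ι → ℝ)) [IsGaussian μ] (i : ι) (L : StrongDual ℝ (ι → ℝ)) :
    ∫ x, x i * L x ∂μ = L (covRow μ i) := by
  rw [covRow, ← L.integral_comp_comm (integrable_eval_smul_self μ i)]
  simp

lemma covRow_apply (μ : Measure (ι → ℝ)) [IsGaussian μ] (i j : ι) :
    covRow μ i j = ∫ x, x i * x j ∂μ :=
  (dual_covRow μ i (ContinuousLinearMap.proj (R := ℝ) (φ := fun _ : ι ↦ ℝ) j)).symm

lemma integral_interpolation_covariance (μ ν : Measure (ι → ℝ)) [IsGaussian μ] [IsGaussian ν]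
    (hμ : ∀ L : StrongDual ℝ (ι → ℝ), ∫ x, L x ∂μ = 0) (a b : ℝ) (i : ι)
    (L : StrongDual ℝ ((ι → ℝ) × (ι → ℝ))) :
    ∫ p, (a * p.1 i + b * p.2 i) * L p ∂(μ.prod ν) = L (a • covRow μ i, b • covRow ν i) := by
  set L₁ : StrongDual ℝ (ι → ℝ) := L ∘L ContinuousLinearMap.inl ℝ _ _ with hL₁
  set L₂ : StrongDual ℝ (ι → ℝ) := L ∘L ContinuousLinearMap.inr ℝ _ _ with hL₂
  have hL : ∀ p, L p = L₁ p.1 + L₂ p.2 := fun p ↦ by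
    rw [hL₁, hL₂]
    simp [← map_add]
  have hcoord : ∀ x : ι → ℝ, x i = ContinuousLinearMap.proj (R := ℝ) (φ := fun _ : ι ↦ ℝ) i x :=
    fun _ ↦ rfl
  have hint : ∀ M N : StrongDual ℝ ((ι → ℝ) × (ι → ℝ)),
      Integrable (fun p ↦ M p * N p) (μ.prod ν) := fun M N ↦
    ((ExpGrowth.clm M).mul (ExpGrowth.clm N)).integrable _
      (Continuous.aestronglyMeasurable (by fun_prop))
  set π := ContinuousLinearMap.proj (R := ℝ) (φ := fun _ : ι ↦ ℝ) i
  set f := ContinuousLinearMap.fst ℝ (ι → ℝ) (ι → ℝ)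
  set s := ContinuousLinearMap.snd ℝ (ι → ℝ) (ι → ℝ)
  have i11 := hint (π ∘L f) (L₁ ∘L f)
  have i12 := hint (π ∘L f) (L₂ ∘L s)
  have i21 := hint (L₁ ∘L f) (π ∘L s)
  have i22 := hint (π ∘L s) (L₂ ∘L s)
  have e11 : ∫ p, (π ∘L f) p * (L₁ ∘L f) p ∂(μ.prod ν) = L₁ (covRow μ i) := by
    rw [← dual_covRow]
    have := integral_fun_fst (μ := μ) (ν := ν) (fun x ↦ π x * L₁ x)
    rw [probReal_univ, one_smul] at this
    exact this
  have e22 : ∫ p, (π ∘L s) p * (L₂ ∘L s) p ∂(μ.prod ν) = L₂ (covRow ν i) := by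
    rw [← dual_covRow]
    have := integral_fun_snd (μ := μ) (ν := ν) (fun x ↦ π x * L₂ x)
    rw [probReal_univ, one_smul] at this
    exact this
  have e12 : ∫ p, (π ∘L f) p * (L₂ ∘L s) p ∂(μ.prod ν) = 0 := by
    have := integral_prod_mul (μ := μ) (ν := ν) (fun x ↦ π x) (fun x ↦ L₂ x)
    rw [hμ π, zero_mul] at this
    exact this
  have e21 : ∫ p, (L₁ ∘L f) p * (π ∘L s) p ∂(μ.prod ν) = 0 := by
    have := integral_prod_mul (μ := μ) (ν := ν) (fun x ↦ L₁ x) (fun x ↦ π x)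
    rw [hμ L₁, zero_mul] at this
    exact this
  calc ∫ p, (a * p.1 i + b * p.2 i) * L p ∂(μ.prod ν)
      = ∫ p, (a * ((π ∘L f) p * (L₁ ∘L f) p) + a * ((π ∘L f) p * (L₂ ∘L s) p)
          + (b * ((L₁ ∘L f) p * (π ∘L s) p) + b * ((π ∘L s) p * (L₂ ∘L s) p))) ∂(μ.prod ν) := by
        congr 1; ext p
        rw [hL]
        simp only [hcoord, ContinuousLinearMap.comp_apply]
        simp only [f, s, ContinuousLinearMap.coe_fst', ContinuousLinearMap.coe_snd']
        ring
    _ = a * L₁ (covRow μ i) + b * L₂ (covRow ν i) := by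
        rw [integral_add, integral_add, integral_add, integral_const_mul, integral_const_mul,
          integral_const_mul, integral_const_mul, e11, e12, e21, e22]
        · ring
        · exact i21.const_mul b
        · exact i22.const_mul b
        · exact i11.const_mul a
        · exact i12.const_mul a
        · exact (i11.const_mul a).add (i12.const_mul a)
        · exact (i21.const_mul b).add (i22.const_mul b)
    _ = L (a • covRow μ i, b • covRow ν i) := by rw [hL]; simp

/-- The rotation interpolation between two independent vectors. -/
noncomputable def interp (θ : ℝ) : ((ι → ℝ) × (ι → ℝ)) →L[ℝ] (ι → ℝ) :=
  Real.cos θ • ContinuousLinearMap.fst ℝ _ _ + Real.sin θ • ContinuousLinearMap.snd ℝ _ _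

omit [Fintype ι] in
lemma interp_apply (θ : ℝ) (p : (ι → ℝ) × (ι → ℝ)) :
    interp θ p = Real.cos θ • p.1 + Real.sin θ • p.2 := rfl

lemma norm_interp_le (θ : ℝ) (p : (ι → ℝ) × (ι → ℝ)) : ‖interp θ p‖ ≤ 2 * ‖p‖ := by
  rw [interp_apply]
  refine (norm_add_le _ _).trans ?_
  rw [norm_smul, norm_smul, Real.norm_eq_abs, Real.norm_eq_abs]
  nlinarith [Real.abs_cos_le_one θ, Real.abs_sin_le_one θ, norm_fst_le p, norm_snd_le p,
    norm_nonneg p.1, norm_nonneg p.2]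

/-- Derivative of a Gaussian average along the rotation interpolation. -/
theorem hasDerivAt_integral_interp (μ ν : Measure (ι → ℝ)) [IsGaussian μ] [IsGaussian ν]
    (hμ : ∀ L : StrongDual ℝ (ι → ℝ), ∫ x, L x ∂μ = 0)
    (hν : ∀ L : StrongDual ℝ (ι → ℝ), ∫ x, L x ∂ν = 0)
    {A K : (ι → ℝ) → ℝ} {K' : ι → (ι → ℝ) → ℝ}
    (hA : ContDiff ℝ 1 A) (hAg : ExpGrowth A) (hAg' : ExpGrowth (fderiv ℝ A))
    (hK : ContDiff ℝ 1 K) (hKK' : ∀ z v, fderiv ℝ K z v = ∑ i, v i * K' i z)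
    (hK' : ∀ i, ContDiff ℝ 1 (K' i)) (hKg : ExpGrowth K) (hKg' : ∀ i, ExpGrowth (K' i))
    (hKg'' : ∀ i, ExpGrowth (fderiv ℝ (K' i))) (θ : ℝ) :
    HasDerivAt (fun θ ↦ ∫ p, A p.1 * K (interp θ p) ∂(μ.prod ν))
      (∫ p, ∑ i, (A p.1 * fderiv ℝ (K' i) (interp θ p)
          ((Real.sin θ * Real.cos θ) • (covRow ν i - covRow μ i))
        - Real.sin θ * K' i (interp θ p) * fderiv ℝ A p.1 (covRow μ i)) ∂(μ.prod ν)) θ := by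
  have hAc := hA.continuous
  have hKc := hK.continuous
  have hK'c := fun i ↦ (hK' i).continuous
  set fs := ContinuousLinearMap.fst ℝ (ι → ℝ) (ι → ℝ) with hfs
  have hAf : ExpGrowth (fun p : (ι → ℝ) × (ι → ℝ) ↦ A p.1) := hAg.comp_clm fs
  choose C hC0 hC using hKg'
  set l : ℝ → ι → StrongDual ℝ ((ι → ℝ) × (ι → ℝ)) := fun θ i ↦
    (ContinuousLinearMap.proj (R := ℝ) (φ := fun _ : ι ↦ ℝ) i) ∘L
      (-Real.sin θ • ContinuousLinearMap.fst ℝ _ _ + Real.cos θ • ContinuousLinearMap.snd ℝ _ _)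
    with hl
  have hlx : ∀ θ i p, l θ i p = -Real.sin θ * p.1 i + Real.cos θ * p.2 i := fun θ i p ↦ by
    simp [hl]
  have hl_le : ∀ θ i p, ‖l θ i p‖ ≤ 2 * ‖p‖ := by
    intro θ i p
    rw [hlx]
    refine (norm_add_le _ _).trans ?_
    rw [norm_mul, norm_mul, norm_neg, Real.norm_eq_abs, Real.norm_eq_abs (Real.cos θ)]
    nlinarith [Real.abs_cos_le_one θ, Real.abs_sin_le_one θ,
      (norm_le_pi_norm p.1 i).trans (norm_fst_le p), (norm_le_pi_norm p.2 i).trans (norm_snd_le p),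
      norm_nonneg (p.1 i), norm_nonneg (p.2 i)]
  have hder := (hasDerivAt_integral_of_dominated_loc_of_deriv_le (μ := μ.prod ν) (x₀ := θ)
    (s := Set.univ) (F := fun θ p ↦ A p.1 * K (interp θ p))
    (F' := fun θ p ↦ A p.1 * ∑ i, l θ i p * K' i (interp θ p))
    (bound := fun p ↦ ‖A p.1‖ * ∑ i, (2 * ‖p‖) * Real.exp (C i * (1 + 2 * ‖p‖)))
    Filter.univ_mem
    (Filter.Eventually.of_forall fun θ ↦ Continuous.aestronglyMeasurable (by fun_prop))
    ((hAf.mul (hKg.comp_clm (interp θ))).integrable _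
      (Continuous.aestronglyMeasurable (by fun_prop)))
    (Continuous.aestronglyMeasurable (by fun_prop))
    (ae_of_all _ fun p θ _ ↦ ?_) ?_ (ae_of_all _ fun p θ _ ↦ ?_)).2
  · refine hder.congr_deriv ?_
    have hhg : ∀ i, ExpGrowth (fun p : (ι → ℝ) × (ι → ℝ) ↦ A p.1 * K' i (interp θ p)) :=
      fun i ↦ hAf.mul (ExpGrowth.comp_clm ⟨C i, hC0 i, hC i⟩ (interp θ))
    have hfd : ∀ i p, HasFDerivAt (fun p : (ι → ℝ) × (ι → ℝ) ↦ A p.1 * K' i (interp θ p))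
        (A p.1 • (fderiv ℝ (K' i) (interp θ p) ∘L interp θ)
          + K' i (interp θ p) • (fderiv ℝ A p.1 ∘L fs)) p := by
      intro i p
      have h1 : HasFDerivAt (fun p : (ι → ℝ) × (ι → ℝ) ↦ A p.1) (fderiv ℝ A p.1 ∘L fs) p :=
        ((hA.differentiable one_ne_zero) p.1).hasFDerivAt.comp p fs.hasFDerivAt
      have h2 : HasFDerivAt (fun p : (ι → ℝ) × (ι → ℝ) ↦ K' i (interp θ p))
          (fderiv ℝ (K' i) (interp θ p) ∘L interp θ) p :=
        (((hK' i).differentiable one_ne_zero) (interp θ p)).hasFDerivAt.comp p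
          (interp θ).hasFDerivAt
      exact h1.mul h2
    have hic : ContDiff ℝ 1 (fun p : (ι → ℝ) × (ι → ℝ) ↦ interp θ p) := by
      simp only [interp_apply]; fun_prop
    have hcd : ∀ i, ContDiff ℝ 1 (fun p : (ι → ℝ) × (ι → ℝ) ↦ A p.1 * K' i (interp θ p)) :=
      fun i ↦ (hA.comp contDiff_fst).mul ((hK' i).comp hic)
    have hfg : ∀ i, ExpGrowth
        (fderiv ℝ (fun p : (ι → ℝ) × (ι → ℝ) ↦ A p.1 * K' i (interp θ p))) := by
      intro i
      have hb : ExpGrowth (fun p : (ι → ℝ) × (ι → ℝ) ↦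
          ‖A p.1‖ * (‖fderiv ℝ (K' i) (interp θ p)‖ * ‖(interp θ : _ →L[ℝ] (ι → ℝ))‖)
          + ‖K' i (interp θ p)‖ * (‖fderiv ℝ A p.1‖ * ‖fs‖)) :=
        (hAf.norm.mul (((hKg'' i).comp_clm (interp θ)).norm.mul (ExpGrowth.const _))).add
          ((ExpGrowth.comp_clm ⟨C i, hC0 i, hC i⟩ (interp θ)).norm.mul
            ((hAg'.comp_clm fs).norm.mul (ExpGrowth.const _)))
      refine hb.of_le fun p ↦ ?_
      rw [(hfd i p).fderiv]
      refine le_trans ?_ (le_abs_self _)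
      refine (norm_add_le _ _).trans ?_
      rw [norm_smul, norm_smul]
      gcongr <;> exact ContinuousLinearMap.opNorm_comp_le _ _
    have hcent : ∀ L : StrongDual ℝ ((ι → ℝ) × (ι → ℝ)), ∫ p, L p ∂(μ.prod ν) = 0 := by
      intro L
      have hL : ∀ p, L p = (L ∘L ContinuousLinearMap.inl ℝ _ _) p.1
          + (L ∘L ContinuousLinearMap.inr ℝ _ _) p.2 := fun p ↦ by
        simp [← map_add]
      simp_rw [hL]
      rw [integral_add]
      · have h1 := integral_fun_fst (μ := μ) (ν := ν)
          (fun x ↦ (L ∘L ContinuousLinearMap.inl ℝ (ι → ℝ) (ι → ℝ)) x)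
        have h2 := integral_fun_snd (μ := μ) (ν := ν)
          (fun x ↦ (L ∘L ContinuousLinearMap.inr ℝ (ι → ℝ) (ι → ℝ)) x)
        rw [h1, h2, hμ, hν]; simp
      · exact ((ExpGrowth.clm (L ∘L ContinuousLinearMap.inl ℝ _ _)).comp_clm fs).integrable _
          (Continuous.aestronglyMeasurable (by fun_prop))
      · exact ((ExpGrowth.clm (L ∘L ContinuousLinearMap.inr ℝ _ _)).comp_clm
          (ContinuousLinearMap.snd ℝ (ι → ℝ) (ι → ℝ))).integrable _
          (Continuous.aestronglyMeasurable (by fun_prop))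
    have hibp := fun i ↦ integral_dual_mul_eq_integral_fderiv (μ.prod ν) hcent (l θ i)
      (-Real.sin θ • covRow μ i, Real.cos θ • covRow ν i)
      (fun L ↦ by
        simp_rw [hlx]
        exact integral_interpolation_covariance μ ν hμ _ _ i L) (hcd i) (hhg i) (hfg i)
    have hib : ∀ i, Integrable (fun p ↦ l θ i p * (A p.1 * K' i (interp θ p))) (μ.prod ν) :=
      fun i ↦ ((ExpGrowth.clm (l θ i)).mul (hhg i)).integrable _
        (Continuous.aestronglyMeasurable (by fun_prop))
    have hib' : ∀ i, Integrable (fun p ↦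
        fderiv ℝ (fun p : (ι → ℝ) × (ι → ℝ) ↦ A p.1 * K' i (interp θ p)) p
          (-Real.sin θ • covRow μ i, Real.cos θ • covRow ν i)) (μ.prod ν) := by
      intro i
      have := (hcd i).continuous_fderiv one_ne_zero
      exact ((hfg i).clm_apply _).integrable _ (Continuous.aestronglyMeasurable (by fun_prop))
    calc ∫ p, A p.1 * ∑ i, l θ i p * K' i (interp θ p) ∂(μ.prod ν)
        = ∫ p, ∑ i, l θ i p * (A p.1 * K' i (interp θ p)) ∂(μ.prod ν) := by
          congr 1; ext p; rw [Finset.mul_sum]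
          exact Finset.sum_congr rfl fun i _ ↦ by ring
      _ = _ := by
          rw [integral_finsetSum _ fun i _ ↦ hib i, Finset.sum_congr rfl fun i _ ↦ hibp i,
            ← integral_finsetSum _ fun i _ ↦ hib' i]
          congr 1; ext p
          refine Finset.sum_congr rfl fun i _ ↦ ?_
          rw [(hfd i p).fderiv]
          simp only [_root_.add_apply, _root_.smul_apply, smul_eq_mul,
            ContinuousLinearMap.comp_apply, interp_apply, hfs, ContinuousLinearMap.coe_fst',
            map_smul, smul_smul]
          rw [show (Real.cos θ * -Real.sin θ) • covRow μ i + (Real.sin θ * Real.cos θ) • covRow ν i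
            = (Real.sin θ * Real.cos θ) • (covRow ν i - covRow μ i) by module, map_smul]
          simp only [smul_eq_mul]
          ring
  · rw [norm_mul]
    refine mul_le_mul_of_nonneg_left ((norm_sum_le _ _).trans (Finset.sum_le_sum fun i _ ↦ ?_))
      (norm_nonneg _)
    rw [norm_mul]
    refine mul_le_mul (hl_le θ i p) ((hC i _).trans (Real.exp_le_exp.2 ?_)) (norm_nonneg _)
      (by positivity)
    exact mul_le_mul_of_nonneg_left (by linarith [norm_interp_le θ p]) (hC0 i)
  · refine ExpGrowth.integrable (hAf.norm.mul (ExpGrowth.sum _ fun i _ ↦ ExpGrowth.mul ?_ ?_)) _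
      (Continuous.aestronglyMeasurable (by fun_prop))
    · refine ExpGrowth.of_linear_bound (K := 2) (by norm_num) fun p ↦ ?_
      rw [norm_mul, norm_norm]; simp
    · refine ⟨2 * C i, by linarith [hC0 i], fun p ↦ ?_⟩
      rw [Real.norm_eq_abs, Real.abs_exp, Real.exp_le_exp]
      nlinarith [hC0 i, norm_nonneg p]
  · have hz : HasDerivAt (fun θ ↦ interp θ p) (-Real.sin θ • p.1 + Real.cos θ • p.2) θ := by
      simp only [interp_apply]
      exact ((Real.hasDerivAt_cos θ).smul_const p.1).add ((Real.hasDerivAt_sin θ).smul_const p.2)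
    have := ((hK.differentiable one_ne_zero) (interp θ p)).hasFDerivAt.comp_hasDerivAt θ hz
    rw [hKK'] at this
    simpa [hlx] using this.const_mul (A p.1)

end Interpolation

section LogSumExp

variable {ι : Type*} [Fintype ι]

/-- The log-sum-exp function. -/
noncomputable def lse (z : ι → ℝ) : ℝ := Real.log (∑ i, Real.exp (z i))

/-- The softmax weights, the gradient of `lse`. -/
noncomputable def softmax (i : ι) (z : ι → ℝ) : ℝ := Real.exp (z i) / ∑ j, Real.exp (z j)

lemma softmax_nonneg (i : ι) (z : ι → ℝ) : 0 ≤ softmax i z :=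
  div_nonneg (Real.exp_nonneg _) (Finset.sum_nonneg fun _ _ ↦ Real.exp_nonneg _)

variable [Nonempty ι]

lemma sum_exp_pos (z : ι → ℝ) : 0 < ∑ i, Real.exp (z i) :=
  Finset.sum_pos (fun _ _ ↦ Real.exp_pos _) Finset.univ_nonempty

lemma sum_softmax (z : ι → ℝ) : ∑ i, softmax i z = 1 := by
  simp_rw [softmax, ← Finset.sum_div]
  exact div_self (sum_exp_pos z).ne'

lemma softmax_le_one (i : ι) (z : ι → ℝ) : softmax i z ≤ 1 := by
  rw [← sum_softmax z]
  exact Finset.single_le_sum (fun j _ ↦ softmax_nonneg j z) (Finset.mem_univ i)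

lemma le_lse (z : ι → ℝ) (k : ι) : z k ≤ lse z := by
  rw [lse, Real.le_log_iff_exp_le (sum_exp_pos z)]
  exact Finset.single_le_sum (f := fun i ↦ Real.exp (z i)) (fun j _ ↦ Real.exp_nonneg _)
    (Finset.mem_univ k)

lemma lse_le {z : ι → ℝ} {M : ℝ} (h : ∀ i, z i ≤ M) :
    lse z ≤ M + Real.log (Fintype.card ι) := by
  have hc : (0 : ℝ) < Fintype.card ι := by exact_mod_cast Fintype.card_pos
  rw [lse, Real.log_le_iff_le_exp (sum_exp_pos z), Real.exp_add, Real.exp_log hc]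
  calc ∑ i, Real.exp (z i) ≤ ∑ _i : ι, Real.exp M :=
        Finset.sum_le_sum fun i _ ↦ Real.exp_le_exp.2 (h i)
    _ = Real.exp M * Fintype.card ι := by simp [mul_comm]

lemma contDiff_lse : ContDiff ℝ 1 (lse : (ι → ℝ) → ℝ) := by
  unfold lse
  exact ContDiff.log (by fun_prop) fun z ↦ (sum_exp_pos z).ne'

lemma contDiff_softmax (i : ι) : ContDiff ℝ 1 (softmax i : (ι → ℝ) → ℝ) := by
  unfold softmax
  exact ContDiff.div (by fun_prop) (by fun_prop) fun z ↦ (sum_exp_pos z).ne'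

omit [Nonempty ι] in
lemma hasFDerivAt_exp_eval (i : ι) (z : ι → ℝ) :
    HasFDerivAt (fun z : ι → ℝ ↦ Real.exp (z i))
      (Real.exp (z i) • ContinuousLinearMap.proj (R := ℝ) (φ := fun _ : ι ↦ ℝ) i) z :=
  (hasFDerivAt_apply i z).exp

omit [Nonempty ι] in
lemma hasFDerivAt_sum_exp (z : ι → ℝ) :
    HasFDerivAt (fun z : ι → ℝ ↦ ∑ i, Real.exp (z i))
      (∑ i, Real.exp (z i) • ContinuousLinearMap.proj (R := ℝ) (φ := fun _ : ι ↦ ℝ) i) z :=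
  HasFDerivAt.fun_sum fun i _ ↦ hasFDerivAt_exp_eval i z

lemma fderiv_lse_apply (z v : ι → ℝ) : fderiv ℝ lse z v = ∑ i, v i * softmax i z := by
  have := ((hasFDerivAt_sum_exp z).log (sum_exp_pos z).ne').fderiv
  unfold lse
  rw [this]
  simp only [_root_.smul_apply, _root_.sum_apply, ContinuousLinearMap.proj_apply, smul_eq_mul,
    Finset.mul_sum, softmax]
  exact Finset.sum_congr rfl fun i _ ↦ by ring

lemma fderiv_softmax_apply (i : ι) (z v : ι → ℝ) :
    fderiv ℝ (softmax i) z v = softmax i z * (v i - ∑ j, v j * softmax j z) := by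
  have hS := sum_exp_pos z
  have heq : ∀ z : ι → ℝ, softmax i z * ∑ j, Real.exp (z j) = Real.exp (z i) := fun z ↦
    div_mul_cancel₀ _ (sum_exp_pos z).ne'
  have h1 := (((contDiff_softmax i).differentiable one_ne_zero) z).hasFDerivAt.mul
    (hasFDerivAt_sum_exp z)
  have h2 := h1.unique ((hasFDerivAt_exp_eval i z).congr_of_eventuallyEq
    (Filter.Eventually.of_forall heq))
  have h3 := DFunLike.congr_fun h2 v
  simp only [_root_.add_apply, _root_.smul_apply, _root_.sum_apply,
    ContinuousLinearMap.proj_apply, smul_eq_mul] at h3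
  have h4 : ∑ j, v j * softmax j z = (∑ j, Real.exp (z j) * v j) / ∑ j, Real.exp (z j) := by
    rw [Finset.sum_div]
    exact Finset.sum_congr rfl fun j _ ↦ by rw [softmax]; ring
  rw [h4]
  have h5 := heq z
  field_simp
  rw [← h5] at h3
  linear_combination h3

lemma abs_sum_mul_softmax_le (z v : ι → ℝ) : |∑ i, v i * softmax i z| ≤ ‖v‖ := by
  refine (Finset.abs_sum_le_sum_abs _ _).trans ?_
  calc ∑ i, |v i * softmax i z| ≤ ∑ i, ‖v‖ * softmax i z := by
        refine Finset.sum_le_sum fun i _ ↦ ?_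
        rw [abs_mul, abs_of_nonneg (softmax_nonneg i z)]
        exact mul_le_mul_of_nonneg_right (norm_le_pi_norm v i) (softmax_nonneg i z)
    _ = ‖v‖ := by rw [← Finset.mul_sum, sum_softmax, mul_one]

lemma expGrowth_fderiv_lse : ExpGrowth (fderiv ℝ (lse : (ι → ℝ) → ℝ)) := by
  refine ExpGrowth.of_bound (K := 1) fun z ↦ ContinuousLinearMap.opNorm_le_bound _ zero_le_one
    fun v ↦ ?_
  rw [fderiv_lse_apply, one_mul]
  exact abs_sum_mul_softmax_le z v

lemma expGrowth_softmax (i : ι) : ExpGrowth (softmax i : (ι → ℝ) → ℝ) := by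
  refine ExpGrowth.of_bound (K := 1) fun z ↦ ?_
  rw [Real.norm_eq_abs, abs_of_nonneg (softmax_nonneg i z)]
  exact softmax_le_one i z

lemma expGrowth_fderiv_softmax (i : ι) :
    ExpGrowth (fderiv ℝ (softmax i : (ι → ℝ) → ℝ)) := by
  refine ExpGrowth.of_bound (K := 2) fun z ↦ ContinuousLinearMap.opNorm_le_bound _ zero_le_two
    fun v ↦ ?_
  rw [fderiv_softmax_apply, norm_mul, Real.norm_eq_abs, Real.norm_eq_abs,
    abs_of_nonneg (softmax_nonneg i z)]
  have h1 := abs_sub (v i) (∑ j, v j * softmax j z)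
  have h2 := abs_sum_mul_softmax_le z v
  have h3 : |v i| ≤ ‖v‖ := norm_le_pi_norm v i
  have h4 := softmax_le_one i z
  have h5 := softmax_nonneg i z
  nlinarith [abs_nonneg (v i - ∑ j, v j * softmax j z)]

lemma abs_lse_le (z : ι → ℝ) : |lse z| ≤ ‖z‖ + Real.log (Fintype.card ι) := by
  have hc : 0 ≤ Real.log (Fintype.card ι) := Real.log_natCast_nonneg _
  have h : ∀ i, |z i| ≤ ‖z‖ := fun i ↦ norm_le_pi_norm z i
  refine abs_le.2 ⟨?_, lse_le fun i ↦ (le_abs_self _).trans (h i)⟩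
  obtain ⟨k⟩ := ‹Nonempty ι›
  have := neg_abs_le (z k)
  linarith [le_lse z k, h k]

lemma expGrowth_lse : ExpGrowth (lse : (ι → ℝ) → ℝ) := by
  have hc : 0 ≤ Real.log (Fintype.card ι) := Real.log_natCast_nonneg _
  refine ExpGrowth.of_linear_bound (K := 1 + Real.log (Fintype.card ι)) (by positivity)
    fun z ↦ (abs_lse_le z).trans ?_
  nlinarith [norm_nonneg z]

lemma expGrowth_exp_lse (t : ℝ) : ExpGrowth (fun z : ι → ℝ ↦ Real.exp (t * lse z)) := by
  have hc : 0 ≤ Real.log (Fintype.card ι) := Real.log_natCast_nonneg _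
  refine ⟨|t| * (1 + Real.log (Fintype.card ι)), by positivity, fun z ↦ ?_⟩
  rw [Real.norm_eq_abs, Real.abs_exp, Real.exp_le_exp]
  calc t * lse z ≤ |t| * |lse z| := by rw [← abs_mul]; exact le_abs_self _
    _ ≤ |t| * ((1 + Real.log (Fintype.card ι)) * (1 + ‖z‖)) := by
        refine mul_le_mul_of_nonneg_left ((abs_lse_le z).trans ?_) (abs_nonneg t)
        nlinarith [norm_nonneg z]
    _ = _ := by ring

lemma continuous_lse : Continuous (lse : (ι → ℝ) → ℝ) := contDiff_lse.continuous

section Comparison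

variable (μ ν : Measure (ι → ℝ)) [IsGaussian μ] [IsGaussian ν]

omit [Nonempty ι] in
lemma integrable_eval_mul_eval (i j : ι) : Integrable (fun x : ι → ℝ ↦ x i * x j) μ :=
  ((ExpGrowth.clm (ContinuousLinearMap.proj (R := ℝ) (φ := fun _ : ι ↦ ℝ) i)).mul
    (ExpGrowth.clm (ContinuousLinearMap.proj (R := ℝ) (φ := fun _ : ι ↦ ℝ) j))).integrable μ
    (Continuous.aestronglyMeasurable (by fun_prop))

omit [Nonempty ι] in
lemma integral_sub_sq_eq_covRow (i j : ι) :
    ∫ x, (x i - x j) ^ 2 ∂μ = covRow μ i i + covRow μ j j - 2 * covRow μ i j := by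
  rw [covRow_apply, covRow_apply, covRow_apply, ← integral_const_mul, ← integral_add,
    ← integral_sub]
  · congr 1; ext x; ring
  · exact (integrable_eval_mul_eval μ i i).add (integrable_eval_mul_eval μ j j)
  · exact (integrable_eval_mul_eval μ i j).const_mul 2
  · exact integrable_eval_mul_eval μ i i
  · exact integrable_eval_mul_eval μ j j

/-- Sudakov–Fernique comparison for the log-sum-exp function. -/
theorem integral_lse_le_of_increments
    (hμ : ∀ L : StrongDual ℝ (ι → ℝ), ∫ x, L x ∂μ = 0)
    (hν : ∀ L : StrongDual ℝ (ι → ℝ), ∫ x, L x ∂ν = 0)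
    (hinc : ∀ i j, ∫ x, (x i - x j) ^ 2 ∂μ ≤ ∫ x, (x i - x j) ^ 2 ∂ν) :
    ∫ x, lse x ∂μ ≤ ∫ x, lse x ∂ν := by
  have hder := hasDerivAt_integral_interp μ ν hμ hν (A := fun _ ↦ 1) (K := lse) (K' := softmax)
    contDiff_const (ExpGrowth.const 1) (ExpGrowth.of_bound (K := 0) fun x ↦ by simp)
    contDiff_lse fderiv_lse_apply contDiff_softmax expGrowth_lse expGrowth_softmax
    expGrowth_fderiv_softmax
  have hmono : MonotoneOn (fun θ ↦ ∫ p, (fun _ : ι → ℝ ↦ (1 : ℝ)) p.1 * lse (interp θ p)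
      ∂(μ.prod ν)) (Set.Icc 0 (Real.pi / 2)) := by
    refine monotoneOn_of_hasDerivWithinAt_nonneg (convex_Icc _ _)
      (fun θ _ ↦ (hder θ).continuousAt.continuousWithinAt)
      (fun θ _ ↦ (hder θ).hasDerivWithinAt) fun θ hθ ↦ ?_
    rw [interior_Icc] at hθ
    have hs : 0 ≤ Real.sin θ := Real.sin_nonneg_of_nonneg_of_le_pi hθ.1.le
      (by linarith [hθ.2, Real.pi_pos])
    have hc : 0 ≤ Real.cos θ := Real.cos_nonneg_of_mem_Icc ⟨by linarith [hθ.1, Real.pi_pos],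
      hθ.2.le⟩
    refine integral_nonneg fun p ↦ ?_
    set D : ι → ι → ℝ := fun i j ↦ covRow ν i j - covRow μ i j with hD
    have hDn : ∀ i j, 0 ≤ D i i + D j j - 2 * D i j := fun i j ↦ by
      have := hinc i j
      rw [integral_sub_sq_eq_covRow, integral_sub_sq_eq_covRow] at this
      simp only [hD]; linarith
    set z := interp θ p
    have hid : ∑ i, softmax i z * (D i i - ∑ j, D i j * softmax j z)
        = 1 / 2 * ∑ i, ∑ j, softmax i z * softmax j z * (D i i + D j j - 2 * D i j) := by
      have e1 : ∑ i, ∑ j, softmax i z * softmax j z * D i i = ∑ i, softmax i z * D i i := by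
        refine Finset.sum_congr rfl fun i _ ↦ ?_
        rw [← Finset.sum_mul, ← Finset.mul_sum, sum_softmax, mul_one]
      have e2 : ∑ i, ∑ j, softmax i z * softmax j z * D j j = ∑ i, softmax i z * D i i := by
        rw [Finset.sum_comm, ← e1]
        exact Finset.sum_congr rfl fun i _ ↦ Finset.sum_congr rfl fun j _ ↦ by ring
      have e3 : ∑ i, ∑ j, softmax i z * softmax j z * (D i i + D j j - 2 * D i j)
          = ∑ i, ∑ j, softmax i z * softmax j z * D i i
            + ∑ i, ∑ j, softmax i z * softmax j z * D j j
            - 2 * ∑ i, ∑ j, softmax i z * softmax j z * D i j := by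
        simp only [Finset.mul_sum, ← Finset.sum_add_distrib, ← Finset.sum_sub_distrib]
        exact Finset.sum_congr rfl fun i _ ↦ Finset.sum_congr rfl fun j _ ↦ by ring
      rw [e3, e1, e2]
      simp only [mul_sub, Finset.sum_sub_distrib, Finset.mul_sum]
      rw [← Finset.sum_add_distrib, Finset.mul_sum, ← Finset.sum_sub_distrib,
        ← Finset.sum_sub_distrib]
      refine Finset.sum_congr rfl fun i _ ↦ ?_
      have : ∀ j, softmax i z * (D i j * softmax j z)
        = 1 / 2 * (2 * (softmax i z * softmax j z * D i j)) := fun j ↦ by ring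
      simp only [this]
      ring
    have hpos : 0 ≤ ∑ i, softmax i z * (D i i - ∑ j, D i j * softmax j z) := by
      rw [hid]
      refine mul_nonneg (by norm_num) (Finset.sum_nonneg fun i _ ↦ Finset.sum_nonneg fun j _ ↦ ?_)
      exact mul_nonneg (mul_nonneg (softmax_nonneg i z) (softmax_nonneg j z)) (hDn i j)
    have : ∑ i, ((1 : ℝ) * fderiv ℝ (softmax i) z
          ((Real.sin θ * Real.cos θ) • (covRow ν i - covRow μ i))
        - Real.sin θ * softmax i z * fderiv ℝ (fun _ : ι → ℝ ↦ (1 : ℝ)) p.1 (covRow μ i))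
        = (Real.sin θ * Real.cos θ) * ∑ i, softmax i z * (D i i - ∑ j, D i j * softmax j z) := by
      rw [Finset.mul_sum]
      refine Finset.sum_congr rfl fun i _ ↦ ?_
      rw [map_smul, fderiv_softmax_apply]
      simp [hD]
    exact this ▸ mul_nonneg (mul_nonneg hs hc) hpos
  have h := hmono (Set.left_mem_Icc.2 (by positivity)) (Set.right_mem_Icc.2 (by positivity))
    (by positivity : (0 : ℝ) ≤ Real.pi / 2)
  simp only [interp_apply, Real.cos_zero, Real.sin_zero, Real.cos_pi_div_two,
    Real.sin_pi_div_two, one_smul, zero_smul, add_zero, zero_add, one_mul] at h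
  have h1 := integral_fun_fst (μ := μ) (ν := ν) (fun x ↦ lse x)
  have h2 := integral_fun_snd (μ := μ) (ν := ν) (fun x ↦ lse x)
  rw [probReal_univ, one_smul] at h1 h2
  rwa [h1, h2] at h

end Comparison

end LogSumExp

section Concentration

variable {ι : Type*} [Fintype ι]

lemma covRow_le (μ : Measure (ι → ℝ)) [IsGaussian μ] {s : ℝ} (hs : ∀ i, ∫ x, x i ^ 2 ∂μ ≤ s)
    (i j : ι) : covRow μ i j ≤ s := by
  have hdiag : ∀ i, covRow μ i i ≤ s := fun i ↦ by
    rw [covRow_apply]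
    simpa only [sq] using hs i
  have h : 0 ≤ ∫ x, (x i - x j) ^ 2 ∂μ := integral_nonneg fun x ↦ sq_nonneg _
  rw [integral_sub_sq_eq_covRow] at h
  linarith [hdiag i, hdiag j]

variable [Nonempty ι]

lemma hasFDerivAt_exp_lse (t : ℝ) (z : ι → ℝ) :
    HasFDerivAt (fun z : ι → ℝ ↦ Real.exp (t * lse z))
      (Real.exp (t * lse z) • (t • fderiv ℝ lse z)) z :=
  (((contDiff_lse.differentiable one_ne_zero) z).hasFDerivAt.const_mul t).exp

lemma contDiff_exp_lse (t : ℝ) : ContDiff ℝ 1 (fun z : ι → ℝ ↦ Real.exp (t * lse z)) :=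
  (contDiff_const.mul contDiff_lse).exp

omit [Nonempty ι] in
lemma integral_comp_interp_self (μ : Measure (ι → ℝ)) [IsGaussian μ]
    (hμ : ∀ L : StrongDual ℝ (ι → ℝ), ∫ x, L x ∂μ = 0) {f : (ι → ℝ) → ℝ} (hf : Continuous f)
    (θ : ℝ) : ∫ p, f (interp θ p) ∂(μ.prod μ) = ∫ x, f x ∂μ := by
  have hrot := IsGaussian.map_rotation_eq_self_of_forall_strongDual_eq_zero hμ θ
  have h1 := integral_fun_fst (μ := μ) (ν := μ) (fun x ↦ f x)
  rw [probReal_univ, one_smul] at h1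
  rw [← h1]
  nth_rw 2 [← hrot]
  rw [integral_map (by fun_prop) (Continuous.aestronglyMeasurable (by fun_prop))]
  rfl

/-- The Gaussian covariance bound behind the concentration of the log-sum-exp function. -/
theorem integral_lse_mul_exp_le (μ : Measure (ι → ℝ)) [IsGaussian μ]
    (hμ : ∀ L : StrongDual ℝ (ι → ℝ), ∫ x, L x ∂μ = 0) {s : ℝ}
    (hs : ∀ i, ∫ x, x i ^ 2 ∂μ ≤ s) {t : ℝ} (ht : 0 ≤ t) :
    ∫ x, lse x * Real.exp (t * lse x) ∂μ
      ≤ (∫ x, lse x ∂μ + t * s) * ∫ x, Real.exp (t * lse x) ∂μ := by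
  set M := ∫ x, Real.exp (t * lse x) ∂μ with hM
  have hE : ∀ θ, Integrable (fun p ↦ Real.exp (t * lse (interp θ p))) (μ.prod μ) := by
    intro θ
    have hg : ExpGrowth (fun p : (ι → ℝ) × (ι → ℝ) ↦ Real.exp (t * lse (interp θ p))) :=
      ExpGrowth.comp_clm (f := fun z : ι → ℝ ↦ Real.exp (t * lse z)) (expGrowth_exp_lse t)
        (interp θ)
    have hc : Continuous (fun p : (ι → ℝ) × (ι → ℝ) ↦ Real.exp (t * lse (interp θ p))) :=
      (contDiff_exp_lse t).continuous.comp (interp θ).continuous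
    exact hg.integrable _ hc.aestronglyMeasurable
  have hgrowth : ∀ i : ι, ExpGrowth (fun z : ι → ℝ ↦ t * (Real.exp (t * lse z) * softmax i z)) :=
    fun i ↦ (ExpGrowth.const t).mul ((expGrowth_exp_lse t).mul (expGrowth_softmax i))
  have hcd : ∀ i : ι, ContDiff ℝ 1
      (fun z : ι → ℝ ↦ t * (Real.exp (t * lse z) * softmax i z)) :=
    fun i ↦ contDiff_const.mul ((contDiff_exp_lse t).mul (contDiff_softmax i))
  have hgrowth' : ∀ i : ι, ExpGrowth
      (fderiv ℝ (fun z : ι → ℝ ↦ t * (Real.exp (t * lse z) * softmax i z))) := by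
    intro i
    have hb : ExpGrowth (fun z : ι → ℝ ↦ ‖t‖ * (‖Real.exp (t * lse z)‖ * ‖fderiv ℝ (softmax i) z‖
        + ‖softmax i z‖ * (‖Real.exp (t * lse z)‖ * (‖t‖ * ‖fderiv ℝ lse z‖)))) :=
      (ExpGrowth.const _).mul (((expGrowth_exp_lse t).norm.mul
        (expGrowth_fderiv_softmax i).norm).add ((expGrowth_softmax i).norm.mul
          ((expGrowth_exp_lse t).norm.mul ((ExpGrowth.const _).mul expGrowth_fderiv_lse.norm))))
    refine hb.of_le fun z ↦ ?_
    have : HasFDerivAt (fun z : ι → ℝ ↦ t * (Real.exp (t * lse z) * softmax i z)) _ z :=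
      ((hasFDerivAt_exp_lse t z).mul
        (((contDiff_softmax i).differentiable one_ne_zero) z).hasFDerivAt).const_mul t
    rw [this.fderiv]
    refine le_trans ?_ (le_abs_self _)
    rw [norm_smul]
    refine mul_le_mul_of_nonneg_left ((norm_add_le _ _).trans ?_) (norm_nonneg _)
    rw [norm_smul, norm_smul, norm_smul, norm_smul]
  have hder := hasDerivAt_integral_interp μ μ hμ hμ (A := lse)
    (K := fun z ↦ Real.exp (t * lse z))
    (K' := fun i z ↦ t * (Real.exp (t * lse z) * softmax i z))
    contDiff_lse expGrowth_lse expGrowth_fderiv_lse (contDiff_exp_lse t)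
    (fun z v ↦ by
      rw [(hasFDerivAt_exp_lse t z).fderiv]
      simp only [_root_.smul_apply, fderiv_lse_apply, smul_eq_mul, Finset.mul_sum]
      exact Finset.sum_congr rfl fun i _ ↦ by ring)
    hcd (expGrowth_exp_lse t) hgrowth hgrowth'
  have hmono : MonotoneOn (fun θ ↦ ∫ p, lse p.1 * Real.exp (t * lse (interp θ p)) ∂(μ.prod μ)
      - t * s * M * Real.cos θ) (Set.Icc 0 (Real.pi / 2)) := by
    refine monotoneOn_of_hasDerivWithinAt_nonneg (convex_Icc _ _)
      (fun θ _ ↦ ((hder θ).sub ((Real.hasDerivAt_cos θ).const_mul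
        (t * s * M))).continuousAt.continuousWithinAt)
      (fun θ _ ↦ ((hder θ).sub ((Real.hasDerivAt_cos θ).const_mul
        (t * s * M))).hasDerivWithinAt) fun θ hθ ↦ ?_
    rw [interior_Icc] at hθ
    have hsin : 0 ≤ Real.sin θ := Real.sin_nonneg_of_nonneg_of_le_pi hθ.1.le
      (by linarith [hθ.2, Real.pi_pos])
    have hMθ : ∫ p, Real.exp (t * lse (interp θ p)) ∂(μ.prod μ) = M :=
      integral_comp_interp_self μ hμ (contDiff_exp_lse t).continuous θ
    have hpt : ∀ p : (ι → ℝ) × (ι → ℝ), -(Real.sin θ * (t * s)) * Real.exp (t * lse (interp θ p))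
        ≤ ∑ i, (lse p.1 * fderiv ℝ (fun z ↦ t * (Real.exp (t * lse z) * softmax i z)) (interp θ p)
            ((Real.sin θ * Real.cos θ) • (covRow μ i - covRow μ i))
          - Real.sin θ * (t * (Real.exp (t * lse (interp θ p)) * softmax i (interp θ p)))
            * fderiv ℝ lse p.1 (covRow μ i)) := by
      intro p
      have hle : ∀ i, fderiv ℝ lse p.1 (covRow μ i) ≤ s := fun i ↦ by
        rw [fderiv_lse_apply]
        calc ∑ j, covRow μ i j * softmax j p.1 ≤ ∑ j, s * softmax j p.1 :=
              Finset.sum_le_sum fun j _ ↦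
                mul_le_mul_of_nonneg_right (covRow_le μ hs i j) (softmax_nonneg j _)
          _ = s := by rw [← Finset.mul_sum, sum_softmax, mul_one]
      calc -(Real.sin θ * (t * s)) * Real.exp (t * lse (interp θ p))
          = ∑ i, -(Real.sin θ * (t * (Real.exp (t * lse (interp θ p))
              * softmax i (interp θ p))) * s) := by
            rw [Finset.sum_neg_distrib, ← Finset.sum_mul, ← Finset.mul_sum, ← Finset.mul_sum,
              ← Finset.mul_sum, sum_softmax]
            ring
        _ ≤ _ := by
            refine Finset.sum_le_sum fun i _ ↦ ?_
            rw [sub_self, smul_zero, map_zero, mul_zero, zero_sub]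
            refine neg_le_neg (mul_le_mul_of_nonneg_left (hle i) ?_)
            have := softmax_nonneg i (interp θ p)
            positivity
    have hint : Integrable (fun p : (ι → ℝ) × (ι → ℝ) ↦
        ∑ i, (lse p.1 * fderiv ℝ (fun z ↦ t * (Real.exp (t * lse z) * softmax i z)) (interp θ p)
            ((Real.sin θ * Real.cos θ) • (covRow μ i - covRow μ i))
          - Real.sin θ * (t * (Real.exp (t * lse (interp θ p)) * softmax i (interp θ p)))
            * fderiv ℝ lse p.1 (covRow μ i))) (μ.prod μ) := by
      refine integrable_finsetSum _ fun i _ ↦ ?_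
      simp only [sub_self, smul_zero, map_zero, mul_zero, zero_sub]
      have hc1 := (hcd i).continuous
      have hc2 := (contDiff_lse (ι := ι)).continuous_fderiv one_ne_zero
      refine Integrable.neg (ExpGrowth.integrable (ExpGrowth.mul ((ExpGrowth.const _).mul
        ((hgrowth i).comp_clm (interp θ))) ((expGrowth_fderiv_lse.comp_clm
          (ContinuousLinearMap.fst ℝ (ι → ℝ) (ι → ℝ))).clm_apply _)) _ ?_)
      refine Continuous.aestronglyMeasurable ?_
      exact (continuous_const.mul (hc1.comp (interp θ).continuous)).mul
        ((hc2.comp continuous_fst).clm_apply continuous_const)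
    have := integral_mono ((hE θ).const_mul _) hint hpt
    rw [integral_const_mul, hMθ] at this
    linarith
  have h := hmono (Set.left_mem_Icc.2 (by positivity)) (Set.right_mem_Icc.2 (by positivity))
    (by positivity : (0 : ℝ) ≤ Real.pi / 2)
  simp only [interp_apply, Real.cos_zero, Real.sin_zero, Real.cos_pi_div_two,
    Real.sin_pi_div_two, one_smul, zero_smul, add_zero, zero_add, mul_one, mul_zero, sub_zero] at h
  have h1 := integral_fun_fst (μ := μ) (ν := μ) (fun x ↦ lse x * Real.exp (t * lse x))
  have h2 := integral_prod_mul (μ := μ) (ν := μ) (fun x ↦ lse x)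
    (fun x ↦ Real.exp (t * lse x))
  rw [probReal_univ, one_smul] at h1
  rw [h1, h2] at h
  linarith

/-- Sub-Gaussian bound on the moment generating function of the log-sum-exp function. -/
theorem mgf_lse_le (μ : Measure (ι → ℝ)) [IsGaussian μ]
    (hμ : ∀ L : StrongDual ℝ (ι → ℝ), ∫ x, L x ∂μ = 0) {s : ℝ}
    (hs : ∀ i, ∫ x, x i ^ 2 ∂μ ≤ s) {t : ℝ} (ht : 0 ≤ t) :
    mgf lse μ t ≤ Real.exp (t * ∫ x, lse x ∂μ + t ^ 2 * s / 2) := by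
  set m := ∫ x, lse x ∂μ
  have huniv : integrableExpSet (lse : (ι → ℝ) → ℝ) μ = Set.univ := by
    ext t
    simp only [integrableExpSet, Set.mem_ofPred_eq, Set.mem_univ, iff_true]
    exact (expGrowth_exp_lse t).integrable _ (contDiff_exp_lse t).continuous.aestronglyMeasurable
  have hd : ∀ t, HasDerivAt (mgf lse μ) (μ[fun x ↦ lse x * Real.exp (t * lse x)]) t := fun t ↦
    hasDerivAt_mgf (by rw [huniv]; simp)
  have he : ∀ t : ℝ, HasDerivAt (fun t : ℝ ↦ Real.exp (-(t * m + t ^ 2 * s / 2)))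
      (Real.exp (-(t * m + t ^ 2 * s / 2)) * -(m + t * s)) t := fun t ↦ by
    refine HasDerivAt.exp (HasDerivAt.neg ?_)
    have h1 := (hasDerivAt_id t).mul_const m
    have h2 := (((hasDerivAt_id t).pow 2).mul_const s).div_const 2
    refine (h1.add h2).congr_deriv ?_
    simp; ring
  have hanti : AntitoneOn (fun t ↦ mgf lse μ t * Real.exp (-(t * m + t ^ 2 * s / 2)))
      (Set.Ici 0) := by
    refine antitoneOn_of_hasDerivWithinAt_nonpos (convex_Ici 0)
      (fun t _ ↦ ((hd t).mul (he t)).continuousAt.continuousWithinAt)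
      (fun t _ ↦ ((hd t).mul (he t)).hasDerivWithinAt) fun t ht ↦ ?_
    rw [interior_Ici] at ht
    have h := integral_lse_mul_exp_le μ hμ hs (le_of_lt (Set.mem_Ioi.1 ht))
    have hp := Real.exp_pos (-(t * m + t ^ 2 * s / 2))
    have : mgf lse μ t = ∫ x, Real.exp (t * lse x) ∂μ := rfl
    rw [this]
    nlinarith
  have h := hanti (Set.mem_Ici.2 le_rfl) (Set.mem_Ici.2 ht) ht
  simp only [mgf_zero, zero_mul, ne_eq, OfNat.ofNat_ne_zero, not_false_eq_true, zero_pow,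
    zero_div, add_zero, neg_zero, Real.exp_zero, mul_one] at h
  rw [Real.exp_neg, ← div_eq_mul_inv, div_le_one (Real.exp_pos _)] at h
  exact h

end Concentration

section Maximum

variable {ι : Type*} [Fintype ι] [Nonempty ι]

/-- The largest coordinate of a vector. -/
noncomputable def maxCoord (z : ι → ℝ) : ℝ := Finset.univ.sup' Finset.univ_nonempty z

lemma le_maxCoord (z : ι → ℝ) (i : ι) : z i ≤ maxCoord z :=
  Finset.le_sup' z (Finset.mem_univ i)

lemma maxCoord_le {z : ι → ℝ} {M : ℝ} (h : ∀ i, z i ≤ M) : maxCoord z ≤ M :=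
  Finset.sup'_le _ _ fun i _ ↦ h i

lemma continuous_maxCoord : Continuous (maxCoord : (ι → ℝ) → ℝ) :=
  Continuous.finset_sup'_apply _ fun i _ ↦ continuous_apply i

lemma abs_maxCoord_le (z : ι → ℝ) : |maxCoord z| ≤ ‖z‖ := by
  refine abs_le.2 ⟨?_, maxCoord_le fun i ↦ (le_abs_self _).trans (norm_le_pi_norm z i)⟩
  obtain ⟨k⟩ := ‹Nonempty ι›
  have h : |z k| ≤ ‖z‖ := norm_le_pi_norm z k
  linarith [neg_abs_le (z k), le_maxCoord z k]

lemma expGrowth_maxCoord : ExpGrowth (maxCoord : (ι → ℝ) → ℝ) :=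
  ExpGrowth.of_linear_bound zero_le_one fun z ↦ (abs_maxCoord_le z).trans (by simp)

lemma mul_maxCoord_le_lse (β : ℝ) (hβ : 0 < β) (z : ι → ℝ) :
    β * maxCoord z ≤ lse (β • z) := by
  rw [← le_div_iff₀' hβ]
  refine maxCoord_le fun i ↦ ?_
  rw [le_div_iff₀' hβ]
  exact le_lse (β • z) i

lemma lse_le_mul_maxCoord (β : ℝ) (hβ : 0 < β) (z : ι → ℝ) :
    lse (β • z) ≤ β * maxCoord z + Real.log (Fintype.card ι) :=
  lse_le fun i ↦ mul_le_mul_of_nonneg_left (le_maxCoord z i) hβ.le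

lemma integrable_maxCoord (μ : Measure (ι → ℝ)) [IsGaussian μ] : Integrable maxCoord μ :=
  expGrowth_maxCoord.integrable μ continuous_maxCoord.aestronglyMeasurable

lemma integrable_lse_smul (μ : Measure (ι → ℝ)) [IsGaussian μ] (β : ℝ) :
    Integrable (fun x ↦ lse (β • x)) μ :=
  (expGrowth_lse.comp_clm (β • ContinuousLinearMap.id ℝ (ι → ℝ))).integrable μ
    (continuous_lse.comp (continuous_const_smul β)).aestronglyMeasurable

lemma integral_lse_smul_le (μ : Measure (ι → ℝ)) [IsGaussian μ] {β : ℝ} (hβ : 0 < β) :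
    ∫ x, lse (β • x) ∂μ ≤ β * ∫ x, maxCoord x ∂μ + Real.log (Fintype.card ι) := by
  have hi := (integrable_maxCoord μ).const_mul β
  calc ∫ x, lse (β • x) ∂μ ≤ ∫ x, (β * maxCoord x + Real.log (Fintype.card ι)) ∂μ :=
        integral_mono (integrable_lse_smul μ β) (hi.add (integrable_const _))
          (lse_le_mul_maxCoord β hβ)
    _ = _ := by
        rw [integral_add hi (integrable_const _), integral_const_mul]; simp

lemma integral_strongDual_map_eq_zero {E F : Type*} [NormedAddCommGroup E] [NormedSpace ℝ E]
    [MeasurableSpace E] [BorelSpace E] [NormedAddCommGroup F] [NormedSpace ℝ F]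
    [MeasurableSpace F] [BorelSpace F] {P : Measure E}
    (hP : ∀ L : StrongDual ℝ E, ∫ x, L x ∂P = 0) (A : E →L[ℝ] F) (L : StrongDual ℝ F) :
    ∫ x, L x ∂(P.map A) = 0 := by
  rw [integral_map A.continuous.aemeasurable
    L.continuous.stronglyMeasurable.aestronglyMeasurable]
  exact hP (L ∘L A)

lemma le_of_forall_pos_mul_le_mul_add {a b c : ℝ}
    (h : ∀ β : ℝ, 0 < β → β * a ≤ β * b + c) : a ≤ b := by
  by_contra! hab
  have h0 : 0 < a - b := sub_pos.2 hab
  have := h ((|c| + 1) / (a - b)) (by positivity)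
  have h2 : (|c| + 1) / (a - b) * (a - b) = |c| + 1 := div_mul_cancel₀ _ h0.ne'
  nlinarith [le_abs_self c]

/-- Sudakov–Fernique comparison of expected maxima. -/
theorem integral_maxCoord_le_of_increments (μ ν : Measure (ι → ℝ)) [IsGaussian μ] [IsGaussian ν]
    (hμ : ∀ L : StrongDual ℝ (ι → ℝ), ∫ x, L x ∂μ = 0)
    (hν : ∀ L : StrongDual ℝ (ι → ℝ), ∫ x, L x ∂ν = 0)
    (hinc : ∀ i j, ∫ x, (x i - x j) ^ 2 ∂μ ≤ ∫ x, (x i - x j) ^ 2 ∂ν) :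
    ∫ x, maxCoord x ∂μ ≤ ∫ x, maxCoord x ∂ν := by
  refine le_of_forall_pos_mul_le_mul_add (c := Real.log (Fintype.card ι)) fun β hβ ↦ ?_
  set S := β • ContinuousLinearMap.id ℝ (ι → ℝ) with hS
  have hmap : ∀ (P : Measure (ι → ℝ)) (f : (ι → ℝ) → ℝ), Continuous f →
      ∫ x, f x ∂(P.map S) = ∫ x, f (β • x) ∂P := fun P f hf ↦
    integral_map S.continuous.aemeasurable hf.aestronglyMeasurable
  have h := integral_lse_le_of_increments (μ.map S) (ν.map S)
    (integral_strongDual_map_eq_zero hμ S) (integral_strongDual_map_eq_zero hν S) fun i j ↦ by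
      rw [hmap _ (fun x ↦ (x i - x j) ^ 2) (by fun_prop),
        hmap _ (fun x ↦ (x i - x j) ^ 2) (by fun_prop)]
      simp only [Pi.smul_apply, smul_eq_mul, ← mul_sub, mul_pow]
      rw [integral_const_mul, integral_const_mul]
      exact mul_le_mul_of_nonneg_left (hinc i j) (by positivity)
  rw [hmap _ _ continuous_lse, hmap _ _ continuous_lse] at h
  calc β * ∫ x, maxCoord x ∂μ = ∫ x, β * maxCoord x ∂μ := (integral_const_mul _ _).symm
    _ ≤ ∫ x, lse (β • x) ∂μ := integral_mono ((integrable_maxCoord μ).const_mul β)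
        (integrable_lse_smul μ β) (mul_maxCoord_le_lse β hβ)
    _ ≤ _ := h.trans (integral_lse_smul_le ν hβ)

/-- Sub-Gaussian bound on the moment generating function of a Gaussian maximum. -/
theorem mgf_maxCoord_le (μ : Measure (ι → ℝ)) [IsGaussian μ]
    (hμ : ∀ L : StrongDual ℝ (ι → ℝ), ∫ x, L x ∂μ = 0) {s : ℝ}
    (hs : ∀ i, ∫ x, x i ^ 2 ∂μ ≤ s) {t : ℝ} (ht : 0 ≤ t) :
    mgf maxCoord μ t ≤ Real.exp (t * ∫ x, maxCoord x ∂μ + t ^ 2 * s / 2) := by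
  have hE : Integrable (fun x ↦ Real.exp (t * maxCoord x)) μ := by
    refine ExpGrowth.integrable ⟨|t|, abs_nonneg t, fun z ↦ ?_⟩ μ
      (Real.continuous_exp.comp (continuous_maxCoord.const_mul t)).aestronglyMeasurable
    rw [Real.norm_eq_abs, Real.abs_exp, Real.exp_le_exp]
    calc t * maxCoord z ≤ |t| * |maxCoord z| := by rw [← abs_mul]; exact le_abs_self _
      _ ≤ |t| * (1 + ‖z‖) :=
          mul_le_mul_of_nonneg_left (by linarith [abs_maxCoord_le z]) (abs_nonneg t)
  rw [← Real.log_le_iff_le_exp (mgf_pos hE)]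
  refine le_of_forall_pos_mul_le_mul_add (c := t * Real.log (Fintype.card ι)) fun β hβ ↦ ?_
  set S := β • ContinuousLinearMap.id ℝ (ι → ℝ) with hS
  have hmap : ∀ f : (ι → ℝ) → ℝ, Continuous f →
      ∫ x, f x ∂(μ.map S) = ∫ x, f (β • x) ∂μ := fun f hf ↦
    integral_map S.continuous.aemeasurable hf.aestronglyMeasurable
  have hg : Continuous fun z : ι → ℝ ↦ Real.exp (t / β * lse z) :=
    (contDiff_exp_lse (t / β)).continuous
  have h1 : mgf maxCoord μ t ≤ mgf lse (μ.map S) (t / β) := by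
    have he : mgf lse (μ.map S) (t / β) = ∫ x, Real.exp (t / β * lse (β • x)) ∂μ := hmap _ hg
    rw [he]
    refine integral_mono hE ?_ fun x ↦ Real.exp_le_exp.2 ?_
    · exact ExpGrowth.integrable (ExpGrowth.comp_clm
        (f := fun z : ι → ℝ ↦ Real.exp (t / β * lse z)) (expGrowth_exp_lse (t / β)) S) μ
        (hg.comp (continuous_const_smul β)).aestronglyMeasurable
    · rw [div_mul_eq_mul_div, mul_div_assoc]
      refine mul_le_mul_of_nonneg_left ?_ ht
      rw [le_div_iff₀' hβ]
      exact mul_maxCoord_le_lse β hβ x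
  have h2 := mgf_lse_le (μ.map S) (integral_strongDual_map_eq_zero hμ S) (s := β ^ 2 * s)
    (fun i ↦ by
      rw [hmap (fun x ↦ x i ^ 2) (by fun_prop)]
      simp only [Pi.smul_apply, smul_eq_mul, mul_pow]
      rw [integral_const_mul]
      exact mul_le_mul_of_nonneg_left (hs i) (by positivity)) (t := t / β) (by positivity)
  rw [hmap _ continuous_lse] at h2
  have h3 := Real.log_le_log (mgf_pos hE) (h1.trans h2)
  rw [Real.log_exp] at h3
  have h4 := mul_le_mul_of_nonneg_left (integral_lse_smul_le μ hβ) (by positivity : 0 ≤ t / β)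
  have h5 := mul_le_mul_of_nonneg_left (h3.trans (add_le_add_left h4 _)) hβ.le
  refine h5.trans (le_of_eq ?_)
  field_simp
  ring

/-- Gaussian concentration of a finite maximum. -/
theorem measure_exists_lt_le (μ : Measure (ι → ℝ)) [IsGaussian μ]
    (hμ : ∀ L : StrongDual ℝ (ι → ℝ), ∫ x, L x ∂μ = 0) {s m r : ℝ} (hs0 : 0 ≤ s) (hr : 0 ≤ r)
    (hs : ∀ i, ∫ x, x i ^ 2 ∂μ ≤ s ^ 2) (hm : ∫ x, maxCoord x ∂μ ≤ m) :
    μ {x | ∃ i, m + s * r < x i} ≤ ENNReal.ofReal (Real.exp (-r ^ 2 / 2)) := by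
  rcases hs0.eq_or_lt with rfl | hs0
  · have hm0 : 0 ≤ m := by
      obtain ⟨k⟩ := ‹Nonempty ι›
      have h := integral_mono (μ := μ)
        ((ExpGrowth.clm (ContinuousLinearMap.proj (R := ℝ) (φ := fun _ : ι ↦ ℝ) k)).integrable μ
          (Continuous.aestronglyMeasurable (by fun_prop))) (integrable_maxCoord μ)
        fun x ↦ le_maxCoord x k
      rw [hμ] at h
      exact h.trans hm
    have hz : ∀ᵐ x ∂μ, ∀ i, x i = 0 := by
      refine ae_all_iff.2 fun i ↦ ?_
      have hi : Integrable (fun x : ι → ℝ ↦ x i ^ 2) μ := by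
        simpa only [sq] using integrable_eval_mul_eval μ i i
      have h0 : ∫ x, x i ^ 2 ∂μ = 0 := le_antisymm (by simpa using hs i)
        (integral_nonneg fun x ↦ sq_nonneg _)
      filter_upwards [(integral_eq_zero_iff_of_nonneg (fun x ↦ sq_nonneg _) hi).1 h0] with x hx
      simpa using hx
    have : μ {x | ∃ i, m + 0 * r < x i} = 0 := by
      refine measure_mono_null (fun x hx ↦ ?_) (ae_iff.1 hz)
      obtain ⟨i, hi⟩ := hx
      intro h
      rw [h i] at hi
      linarith
    rw [this]; exact zero_le
  · have ht : 0 ≤ r / s := by positivity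
    have hE : Integrable (fun x ↦ Real.exp (r / s * maxCoord x)) μ := by
      refine ExpGrowth.integrable ⟨r / s, ht, fun z ↦ ?_⟩ μ
        (Real.continuous_exp.comp (continuous_maxCoord.const_mul _)).aestronglyMeasurable
      rw [Real.norm_eq_abs, Real.abs_exp, Real.exp_le_exp]
      exact mul_le_mul_of_nonneg_left (by linarith [abs_maxCoord_le z, le_abs_self (maxCoord z)]) ht
    have h := measure_ge_le_exp_mul_mgf (m + s * r) ht hE
    have h' := mgf_maxCoord_le μ hμ hs ht
    have hexp : Real.exp (-(r / s) * (m + s * r)) * mgf maxCoord μ (r / s)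
        ≤ Real.exp (-r ^ 2 / 2) := by
      refine (mul_le_mul_of_nonneg_left h' (Real.exp_nonneg _)).trans ?_
      rw [← Real.exp_add, Real.exp_le_exp]
      have h4 := mul_le_mul_of_nonneg_left hm ht
      have h5 : (r / s) ^ 2 * s ^ 2 = r ^ 2 := by field_simp
      have h6 : r / s * (m + s * r) = r / s * m + r ^ 2 := by field_simp
      linarith
    calc μ {x | ∃ i, m + s * r < x i} ≤ μ {x | m + s * r ≤ maxCoord x} :=
          measure_mono fun x ⟨i, hi⟩ ↦ hi.le.trans (le_maxCoord x i)
      _ = ENNReal.ofReal (μ.real {x | m + s * r ≤ maxCoord x}) :=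
          (ofReal_measureReal).symm
      _ ≤ _ := ENNReal.ofReal_le_ofReal (h.trans hexp)

end Maximum

section LinearFamilies

variable {E F : Type*} [NormedAddCommGroup E] [NormedSpace ℝ E] [MeasurableSpace E] [BorelSpace E]
  [NormedAddCommGroup F] [NormedSpace ℝ F] [MeasurableSpace F] [BorelSpace F]

/-- Sudakov–Fernique comparison for finite families of linear functionals. -/
theorem integral_maxCoord_dual_le {ι : Type*} [Fintype ι] [Nonempty ι]
    (P : Measure E) [IsGaussian P] (Q : Measure F) [IsGaussian Q]
    (hP : ∀ L : StrongDual ℝ E, ∫ x, L x ∂P = 0) (hQ : ∀ L : StrongDual ℝ F, ∫ x, L x ∂Q = 0)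
    (a : ι → StrongDual ℝ E) (b : ι → StrongDual ℝ F)
    (hinc : ∀ i j, ∫ x, (a i x - a j x) ^ 2 ∂P ≤ ∫ y, (b i y - b j y) ^ 2 ∂Q) :
    ∫ x, maxCoord (fun i ↦ a i x) ∂P ≤ ∫ y, maxCoord (fun i ↦ b i y) ∂Q := by
  set A : E →L[ℝ] (ι → ℝ) := ContinuousLinearMap.pi a
  set B : F →L[ℝ] (ι → ℝ) := ContinuousLinearMap.pi b
  have hA : ∀ f : (ι → ℝ) → ℝ, Continuous f →
      ∫ x, f x ∂(P.map A) = ∫ x, f (fun i ↦ a i x) ∂P := fun f hf ↦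
    integral_map A.continuous.aemeasurable hf.aestronglyMeasurable
  have hB : ∀ f : (ι → ℝ) → ℝ, Continuous f →
      ∫ x, f x ∂(Q.map B) = ∫ x, f (fun i ↦ b i x) ∂Q := fun f hf ↦
    integral_map B.continuous.aemeasurable hf.aestronglyMeasurable
  have h := integral_maxCoord_le_of_increments (P.map A) (Q.map B)
    (integral_strongDual_map_eq_zero hP A) (integral_strongDual_map_eq_zero hQ B) fun i j ↦ by
      rw [hA (fun x ↦ (x i - x j) ^ 2) (by fun_prop), hB (fun x ↦ (x i - x j) ^ 2) (by fun_prop)]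
      exact hinc i j
  rwa [hA _ continuous_maxCoord, hB _ continuous_maxCoord] at h

/-- Gaussian concentration for the supremum of a countable family of linear functionals. -/
theorem measure_exists_lt_dual_le (P : Measure E) [IsGaussian P]
    (hP : ∀ L : StrongDual ℝ E, ∫ x, L x ∂P = 0) (a : ℕ → StrongDual ℝ E) {s m r : ℝ}
    (hs0 : 0 ≤ s) (hr : 0 ≤ r) (hs : ∀ k, ∫ x, a k x ^ 2 ∂P ≤ s ^ 2)
    (hm : ∀ N : ℕ, ∫ x, maxCoord (fun k : Fin (N + 1) ↦ a k x) ∂P ≤ m) :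
    P {x | ∃ k, m + s * r < a k x} ≤ ENNReal.ofReal (Real.exp (-r ^ 2 / 2)) := by
  set U : ℕ → Set E := fun N ↦ {x | ∃ k : Fin (N + 1), m + s * r < a k x} with hU
  have hUm : Monotone U := fun N M hNM x ⟨k, hk⟩ ↦
    ⟨⟨k, by have := k.2; omega⟩, hk⟩
  have hUn : {x | ∃ k, m + s * r < a k x} = ⋃ N, U N := by
    ext x
    simp only [hU, Set.mem_iUnion, Set.mem_ofPred_eq]
    exact ⟨fun ⟨k, hk⟩ ↦ ⟨k, ⟨k, by omega⟩, hk⟩, fun ⟨N, k, hk⟩ ↦ ⟨k, hk⟩⟩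
  rw [hUn, hUm.measure_iUnion]
  refine iSup_le fun N ↦ ?_
  set A : E →L[ℝ] (Fin (N + 1) → ℝ) := ContinuousLinearMap.pi fun k : Fin (N + 1) ↦ a k
  have hA : ∀ f : (Fin (N + 1) → ℝ) → ℝ, Continuous f →
      ∫ x, f x ∂(P.map A) = ∫ x, f (fun i ↦ a i x) ∂P := fun f hf ↦
    integral_map A.continuous.aemeasurable hf.aestronglyMeasurable
  have h := measure_exists_lt_le (P.map A) (integral_strongDual_map_eq_zero hP A) hs0 hr
    (fun i ↦ by
      rw [hA (fun x ↦ x i ^ 2) (by fun_prop)]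
      exact hs i) (m := m) (by
      rw [hA _ continuous_maxCoord]
      exact hm N)
  refine le_trans (le_of_eq ?_) h
  rw [Measure.map_apply A.continuous.measurable]
  · rfl
  · simp only [Set.ofPred_exists]
    exact MeasurableSet.iUnion fun i ↦ measurableSet_lt measurable_const (measurable_pi_apply i)

end LinearFamilies

section Chevet

/-- The linear functional with the given coefficients. -/
noncomputable def coeffDual {κ : Type*} [Fintype κ] (c : κ → ℝ) : StrongDual ℝ (κ → ℝ) :=
  ∑ i, c i • ContinuousLinearMap.proj (R := ℝ) (φ := fun _ : κ ↦ ℝ) i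

lemma coeffDual_apply {κ : Type*} [Fintype κ] (c x : κ → ℝ) :
    coeffDual c x = ∑ i, c i * x i := by
  simp [coeffDual, _root_.sum_apply]

lemma coeffDual_sub {κ : Type*} [Fintype κ] (c d x : κ → ℝ) :
    coeffDual c x - coeffDual d x = ∑ i, (c i - d i) * x i := by
  simp only [coeffDual_apply, sub_mul, Finset.sum_sub_distrib]

/-- There is a standard Gaussian measure on `κ → ℝ`. -/
lemma exists_standard_gaussian (κ : Type*) [Fintype κ] :
    ∃ Q : Measure (κ → ℝ), IsGaussian Q ∧ (∀ L : StrongDual ℝ (κ → ℝ), ∫ x, L x ∂Q = 0) ∧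
      ∀ c : κ → ℝ, ∫ x, (∑ i, c i * x i) ^ 2 ∂Q = ∑ i, c i ^ 2 := by
  set e : EuclideanSpace ℝ κ →L[ℝ] (κ → ℝ) :=
    (EuclideanSpace.equiv κ ℝ : EuclideanSpace ℝ κ →L[ℝ] (κ → ℝ))
  refine ⟨(stdGaussian (EuclideanSpace ℝ κ)).map e, inferInstance,
    integral_strongDual_map_eq_zero integral_strongDual_stdGaussian e, fun c ↦ ?_⟩
  rw [integral_map e.continuous.aemeasurable (Continuous.aestronglyMeasurable (by fun_prop))]
  set L : StrongDual ℝ (EuclideanSpace ℝ κ) := innerSL ℝ (WithLp.toLp 2 c) with hL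
  have h := variance_dual_stdGaussian L
  rw [variance_eq_integral L.continuous.aemeasurable, integral_strongDual_stdGaussian] at h
  have hn : ‖L‖ ^ 2 = ∑ i, c i ^ 2 := by
    rw [hL, innerSL_apply_norm, EuclideanSpace.norm_sq_eq]
    simp
  rw [← hn, ← h]
  congr 1; ext x
  simp [hL, e, PiLp.inner_apply, mul_comm]

lemma expGrowth_sqrt_sum_sq {E γ : Type*} [NormedAddCommGroup E] [NormedSpace ℝ E] [Fintype γ]
    (L : γ → StrongDual ℝ E) : ExpGrowth (fun y ↦ √(∑ j, L j y ^ 2)) := by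
  have h : ExpGrowth (fun y ↦ 1 + ∑ j, L j y * L j y) :=
    (ExpGrowth.const 1).add (ExpGrowth.sum _ fun j _ ↦
      (ExpGrowth.clm (L j)).mul (ExpGrowth.clm (L j)))
  refine h.of_le fun y ↦ ?_
  simp only [← sq]
  have h0 : 0 ≤ ∑ j, L j y ^ 2 := Finset.sum_nonneg fun j _ ↦ sq_nonneg _
  rw [Real.norm_eq_abs, Real.norm_eq_abs, abs_of_nonneg (Real.sqrt_nonneg _),
    abs_of_nonneg (by positivity), Real.sqrt_le_left (by positivity)]
  nlinarith

lemma integrable_sqrt_sum_sq {E γ : Type*} [NormedAddCommGroup E] [NormedSpace ℝ E]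
    [MeasurableSpace E] [BorelSpace E] [SecondCountableTopology E] [CompleteSpace E] [Fintype γ]
    (Q : Measure E) [IsGaussian Q] (L : γ → StrongDual ℝ E) :
    Integrable (fun y ↦ √(∑ j, L j y ^ 2)) Q :=
  (expGrowth_sqrt_sum_sq L).integrable Q (Continuous.aestronglyMeasurable (by fun_prop))

lemma integral_sqrt_sum_sq_le {E γ : Type*} [NormedAddCommGroup E] [NormedSpace ℝ E]
    [MeasurableSpace E] [BorelSpace E] [SecondCountableTopology E] [CompleteSpace E] [Fintype γ]
    (Q : Measure E) [IsGaussian Q] (L : γ → StrongDual ℝ E) :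
    ∫ y, √(∑ j, L j y ^ 2) ∂Q ≤ √(∑ j, ∫ y, L j y ^ 2 ∂Q) := by
  have hi : ∀ j, Integrable (fun y ↦ L j y ^ 2) Q := fun j ↦ by
    simp only [sq]
    exact ((ExpGrowth.clm (L j)).mul (ExpGrowth.clm (L j))).integrable Q
      (Continuous.aestronglyMeasurable (by fun_prop))
  have h1 := integrable_sqrt_sum_sq Q L
  set m := ∫ y, √(∑ j, L j y ^ 2) ∂Q
  have hexp : ∀ y, (√(∑ j, L j y ^ 2) - m) ^ 2
      = ∑ j, L j y ^ 2 - 2 * m * √(∑ j, L j y ^ 2) + m ^ 2 := fun y ↦ by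
    rw [sub_sq, Real.sq_sqrt (Finset.sum_nonneg fun j _ ↦ sq_nonneg _)]; ring
  have h0 : 0 ≤ ∫ y, (√(∑ j, L j y ^ 2) - m) ^ 2 ∂Q := integral_nonneg fun y ↦ sq_nonneg _
  simp_rw [hexp] at h0
  have hs : Integrable (fun y ↦ ∑ j, L j y ^ 2) Q := integrable_finsetSum _ fun j _ ↦ hi j
  have hsub : Integrable (fun y ↦ ∑ j, L j y ^ 2 - 2 * m * √(∑ j, L j y ^ 2)) Q :=
    hs.sub (h1.const_mul _)
  rw [integral_add hsub (integrable_const _), integral_sub hs (h1.const_mul _), integral_const_mul,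
    integral_finsetSum _ fun j _ ↦ hi j] at h0
  simp only [integral_const, probReal_univ, one_smul] at h0
  refine (le_abs_self _).trans (Real.abs_le_sqrt ?_)
  nlinarith

lemma sum_mul_le_sqrt {κ : Type*} [Fintype κ] {c y : κ → ℝ} (hc : ∑ i, c i ^ 2 ≤ 1) :
    ∑ i, c i * y i ≤ √(∑ i, y i ^ 2) := by
  refine (Real.sum_mul_le_sqrt_mul_sqrt _ _ _).trans ?_
  exact mul_le_of_le_one_left (Real.sqrt_nonneg _) (Real.sqrt_le_one.2 hc)

variable {α β γ : Type*} [Fintype α] [Fintype β] [Fintype γ]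

lemma sum_sq_sub_tensor_le {u u' : α → ℝ} {w w' : β → ℝ} (hu : ∑ a, u a ^ 2 ≤ 1)
    (hu' : ∑ a, u' a ^ 2 ≤ 1) :
    ∑ p : α × β, (u p.1 * w p.2 - u' p.1 * w' p.2) ^ 2
      ≤ ∑ a, (√(∑ b, w b ^ 2) * u a - √(∑ b, w' b ^ 2) * u' a) ^ 2 + ∑ b, (w b - w' b) ^ 2 := by
  set W := √(∑ b, w b ^ 2)
  set W' := √(∑ b, w' b ^ 2)
  have hW : W ^ 2 = ∑ b, w b ^ 2 := Real.sq_sqrt (Finset.sum_nonneg fun _ _ ↦ sq_nonneg _)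
  have hW' : W' ^ 2 = ∑ b, w' b ^ 2 := Real.sq_sqrt (Finset.sum_nonneg fun _ _ ↦ sq_nonneg _)
  have hd : ∑ b, w b * w' b ≤ W * W' := Real.sum_mul_le_sqrt_mul_sqrt _ _ _
  have hc : ∑ a, u a * u' a ≤ 1 := by
    refine (sum_mul_le_sqrt hu).trans (Real.sqrt_le_one.2 hu')
  have hprod : ∀ (f : α → ℝ) (g : β → ℝ), ∑ p : α × β, f p.1 * g p.2 = (∑ a, f a) * ∑ b, g b :=
    fun f g ↦ by rw [Finset.sum_mul_sum, Fintype.sum_prod_type]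
  have hl : ∑ p : α × β, (u p.1 * w p.2 - u' p.1 * w' p.2) ^ 2
      = (∑ a, u a ^ 2) * W ^ 2 + (∑ a, u' a ^ 2) * W' ^ 2
        - 2 * ((∑ a, u a * u' a) * ∑ b, w b * w' b) := by
    rw [hW, hW', ← hprod, ← hprod, ← hprod, Finset.mul_sum, ← Finset.sum_add_distrib,
      ← Finset.sum_sub_distrib]
    exact Finset.sum_congr rfl fun p _ ↦ by ring
  have hr1 : ∑ a, (W * u a - W' * u' a) ^ 2
      = W ^ 2 * ∑ a, u a ^ 2 + W' ^ 2 * ∑ a, u' a ^ 2 - 2 * W * W' * ∑ a, u a * u' a := by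
    rw [Finset.mul_sum, Finset.mul_sum, Finset.mul_sum, ← Finset.sum_add_distrib,
      ← Finset.sum_sub_distrib]
    exact Finset.sum_congr rfl fun p _ ↦ by ring
  have hr2 : ∑ b, (w b - w' b) ^ 2 = W ^ 2 + W' ^ 2 - 2 * ∑ b, w b * w' b := by
    rw [hW, hW', Finset.mul_sum, ← Finset.sum_add_distrib, ← Finset.sum_sub_distrib]
    exact Finset.sum_congr rfl fun p _ ↦ by ring
  rw [hl, hr1, hr2]
  nlinarith [sq_nonneg (W - W'), mul_nonneg (sub_nonneg.2 hc) (sub_nonneg.2 hd)]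

/-- **Chevet's inequality** for the bilinear forms `uᵀ X hᵀ v` of a Gaussian matrix `X`. -/
theorem integral_maxCoord_bilin_le {ι : Type*} [Fintype ι] [Nonempty ι]
    (P : Measure (α × β → ℝ)) [IsGaussian P]
    (hP : ∀ L : StrongDual ℝ (α × β → ℝ), ∫ x, L x ∂P = 0) {σ : ℝ} (hσ : 0 ≤ σ)
    (hvar : ∀ c : α × β → ℝ, ∫ x, (∑ p, c p * x p) ^ 2 ∂P ≤ σ ^ 2 * ∑ p, c p ^ 2)
    (h : γ → β → ℝ) {R : ℝ}
    (hR : ∀ v : γ → ℝ, ∑ j, v j ^ 2 ≤ 1 → √(∑ b, (∑ j, v j * h j b) ^ 2) ≤ R)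
    (u : ι → α → ℝ) (v : ι → γ → ℝ) (hu : ∀ k, ∑ a, u k a ^ 2 ≤ 1)
    (hv : ∀ k, ∑ j, v k j ^ 2 ≤ 1) :
    ∫ x, maxCoord (fun k ↦ coeffDual (fun p : α × β ↦ u k p.1 * ∑ j, v k j * h j p.2) x) ∂P
      ≤ σ * (R * √(Fintype.card α) + √(∑ j, ∑ b, h j b ^ 2)) := by
  classical
  obtain ⟨Q, hQG, hQ, hQv⟩ := exists_standard_gaussian (α ⊕ β)
  set w : ι → β → ℝ := fun k b ↦ ∑ j, v k j * h j b with hw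
  set W : ι → ℝ := fun k ↦ √(∑ b, w k b ^ 2) with hW
  set c : ι → α ⊕ β → ℝ := fun k ↦ Sum.elim (fun a ↦ σ * (W k * u k a)) (fun b ↦ σ * w k b)
    with hc
  have hR0 : 0 ≤ R := (Real.sqrt_nonneg _).trans (hR 0 (by simp))
  have hcmp := integral_maxCoord_dual_le P Q hP hQ
    (fun k ↦ coeffDual (fun p : α × β ↦ u k p.1 * w k p.2)) (fun k ↦ coeffDual (c k))
    fun i j ↦ by
      simp only [coeffDual_sub]
      rw [hQv]
      refine (hvar _).trans ?_
      refine (mul_le_mul_of_nonneg_left (sum_sq_sub_tensor_le (hu i) (hu j))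
        (sq_nonneg σ)).trans (le_of_eq ?_)
      simp only [hc, Fintype.sum_sum_type, Sum.elim_inl, Sum.elim_inr, ← mul_sub, mul_pow,
        ← Finset.mul_sum, ← mul_add]
      rfl
  refine hcmp.trans ?_
  set L₁ : α → StrongDual ℝ (α ⊕ β → ℝ) := fun a ↦ coeffDual (Pi.single (Sum.inl a) 1)
  set L₂ : γ → StrongDual ℝ (α ⊕ β → ℝ) := fun j ↦ coeffDual (Sum.elim 0 (h j))
  have hL₁ : ∀ a y, L₁ a y = y (Sum.inl a) := fun a y ↦ by
    simp only [L₁, coeffDual_apply, Pi.single_apply, ite_mul, one_mul, zero_mul,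
      Finset.sum_ite_eq', Finset.mem_univ, if_true]
  have hL₂ : ∀ j y, L₂ j y = ∑ b, h j b * y (Sum.inr b) := fun j y ↦ by
    simp [L₂, coeffDual_apply, Fintype.sum_sum_type]
  have hb : ∀ y, maxCoord (fun k ↦ coeffDual (c k) y)
      ≤ σ * (R * √(∑ a, L₁ a y ^ 2) + √(∑ j, L₂ j y ^ 2)) := by
    intro y
    refine maxCoord_le fun k ↦ ?_
    have e : coeffDual (c k) y = σ * (W k * ∑ a, u k a * L₁ a y + ∑ j, v k j * L₂ j y) := by
      simp only [coeffDual_apply, hc, Fintype.sum_sum_type, Sum.elim_inl, Sum.elim_inr, hL₁, hL₂,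
        mul_add, Finset.mul_sum, hw, Finset.sum_mul]
      congr 1
      · exact Finset.sum_congr rfl fun a _ ↦ by ring
      · rw [Finset.sum_comm]
        exact Finset.sum_congr rfl fun a _ ↦ Finset.sum_congr rfl fun b _ ↦ by ring
    rw [e]
    refine mul_le_mul_of_nonneg_left (add_le_add ?_ (sum_mul_le_sqrt (hv k))) hσ
    calc W k * ∑ a, u k a * L₁ a y ≤ W k * √(∑ a, L₁ a y ^ 2) :=
          mul_le_mul_of_nonneg_left (sum_mul_le_sqrt (hu k)) (Real.sqrt_nonneg _)
      _ ≤ _ := mul_le_mul_of_nonneg_right (hR _ (hv k)) (Real.sqrt_nonneg _)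
  have i1 := integrable_sqrt_sum_sq Q L₁
  have i2 := integrable_sqrt_sum_sq Q L₂
  have hi : Integrable (fun y ↦ maxCoord (fun k ↦ coeffDual (c k) y)) Q :=
    (expGrowth_maxCoord.comp_clm (ContinuousLinearMap.pi fun k ↦ coeffDual (c k))).integrable Q
      (continuous_maxCoord.comp
        (ContinuousLinearMap.pi fun k ↦ coeffDual (c k)).continuous).aestronglyMeasurable
  refine (integral_mono hi (((i1.const_mul R).add i2).const_mul σ) hb).trans ?_
  simp only [Pi.add_apply]
  rw [integral_const_mul, integral_add (i1.const_mul R) i2, integral_const_mul]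
  refine mul_le_mul_of_nonneg_left (add_le_add (mul_le_mul_of_nonneg_left ?_ hR0) ?_) hσ
  · refine (integral_sqrt_sum_sq_le Q L₁).trans (le_of_eq ?_)
    congr 1
    have : ∀ a, ∫ y, L₁ a y ^ 2 ∂Q = 1 := fun a ↦ by
      simp only [L₁, coeffDual_apply]
      rw [hQv]
      simp [Pi.single_apply]
    simp [this]
  · refine (integral_sqrt_sum_sq_le Q L₂).trans (le_of_eq ?_)
    congr 1
    refine Finset.sum_congr rfl fun j _ ↦ ?_
    simp only [L₂, coeffDual_apply]
    rw [hQv]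
    simp [Fintype.sum_sum_type]

end Chevet

section Events

/-- The Euclidean unit ball of `κ → ℝ`. -/
def euclBall (κ : Type*) [Fintype κ] : Set (κ → ℝ) := {u | ∑ i, u i ^ 2 ≤ 1}

instance (κ : Type*) [Fintype κ] : Nonempty (euclBall κ) := ⟨⟨0, by simp [euclBall]⟩⟩

lemma isCompact_euclBall (κ : Type*) [Fintype κ] : IsCompact (euclBall κ) := by
  refine Metric.isCompact_of_isClosed_isBounded
    (isClosed_le (by fun_prop) continuous_const) ?_
  refine (Metric.isBounded_closedBall (x := (0 : κ → ℝ)) (r := 1)).subset fun u hu ↦ ?_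
  rw [mem_closedBall_zero_iff, pi_norm_le_iff_of_nonneg zero_le_one]
  intro i
  rw [Real.norm_eq_abs, ← sq_le_one_iff_abs_le_one]
  exact (Finset.single_le_sum (f := fun i ↦ u i ^ 2) (fun j _ ↦ sq_nonneg _)
    (Finset.mem_univ i)).trans hu

/-- Gaussian concentration for the supremum of a continuously parametrized family of linear
functionals. -/
theorem measure_exists_lt_coeffDual_le {κ X : Type*} [Fintype κ] [TopologicalSpace X]
    [TopologicalSpace.SeparableSpace X] [Nonempty X] (P : Measure (κ → ℝ)) [IsGaussian P]
    (hP : ∀ L : StrongDual ℝ (κ → ℝ), ∫ x, L x ∂P = 0) {a : X → κ → ℝ} (ha : Continuous a)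
    {s m r : ℝ} (hs0 : 0 ≤ s) (hr : 0 ≤ r)
    (hs : ∀ t, ∫ x, (∑ i, a t i * x i) ^ 2 ∂P ≤ s ^ 2)
    (hm : ∀ (N : ℕ) (t : Fin (N + 1) → X),
      ∫ x, maxCoord (fun k ↦ coeffDual (a (t k)) x) ∂P ≤ m) :
    P {x | ∃ t, m + s * r < coeffDual (a t) x} ≤ ENNReal.ofReal (Real.exp (-r ^ 2 / 2)) := by
  refine le_trans (measure_mono fun x ⟨t, ht⟩ ↦ ?_)
    (measure_exists_lt_dual_le P hP (fun k ↦ coeffDual (a (TopologicalSpace.denseSeq X k)))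
      hs0 hr (fun k ↦ by simpa only [coeffDual_apply] using hs _)
      (fun N ↦ hm N fun k ↦ TopologicalSpace.denseSeq X k))
  have hopen : IsOpen {t : X | m + s * r < coeffDual (a t) x} := by
    simp only [coeffDual_apply]
    exact isOpen_lt continuous_const (by fun_prop)
  obtain ⟨k, hk⟩ := (TopologicalSpace.denseRange_denseSeq X).exists_mem_open hopen ⟨t, ht⟩
  exact ⟨k, hk⟩

lemma continuous_euclBall_apply {κ X : Type*} [Fintype κ] [TopologicalSpace X]
    {f : X → euclBall κ} (hf : Continuous f) (i : κ) : Continuous fun t ↦ (f t).1 i :=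
  (continuous_apply i).comp (continuous_subtype_val.comp hf)

variable {α β γ : Type*} [Fintype α] [Fintype β] [Fintype γ]

lemma sum_sq_tensor (u : α → ℝ) (w : β → ℝ) :
    ∑ p : α × β, (u p.1 * w p.2) ^ 2 = (∑ a, u a ^ 2) * ∑ b, w b ^ 2 := by
  simp only [mul_pow]
  rw [Finset.sum_mul_sum, Fintype.sum_prod_type]

/-- Conditional bound for the bilinear forms `uᵀ X hᵀ v`. -/
theorem measure_exists_bilin_lt_le (P : Measure (α × β → ℝ)) [IsGaussian P]
    (hP : ∀ L : StrongDual ℝ (α × β → ℝ), ∫ x, L x ∂P = 0) {σ : ℝ} (hσ : 0 ≤ σ)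
    (hvar : ∀ c : α × β → ℝ, ∫ x, (∑ p, c p * x p) ^ 2 ∂P ≤ σ ^ 2 * ∑ p, c p ^ 2)
    (h : γ → β → ℝ) {R : ℝ}
    (hR : ∀ v : γ → ℝ, ∑ j, v j ^ 2 ≤ 1 → √(∑ b, (∑ j, v j * h j b) ^ 2) ≤ R)
    {r : ℝ} (hr : 0 ≤ r) :
    P {x | ∃ t : euclBall α × euclBall γ,
      σ * (R * √(Fintype.card α) + √(∑ j, ∑ b, h j b ^ 2)) + σ * R * r
        < coeffDual (fun p : α × β ↦ t.1.1 p.1 * ∑ j, t.2.1 j * h j p.2) x}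
      ≤ ENNReal.ofReal (Real.exp (-r ^ 2 / 2)) := by
  have hR0 : 0 ≤ R := (Real.sqrt_nonneg _).trans (hR 0 (by simp))
  refine measure_exists_lt_coeffDual_le P hP
    (a := fun (t : euclBall α × euclBall γ) (p : α × β) ↦ t.1.1 p.1 * ∑ j, t.2.1 j * h j p.2)
    (continuous_pi fun p ↦ (continuous_euclBall_apply continuous_fst p.1).mul
      (continuous_finsetSum _ fun j _ ↦
        (continuous_euclBall_apply continuous_snd j).mul continuous_const)) (by positivity) hr
    (fun t ↦ (hvar _).trans ?_)
    fun N t ↦ integral_maxCoord_bilin_le P hP hσ hvar h hR (fun k ↦ (t k).1.1)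
      (fun k ↦ (t k).2.1) (fun k ↦ (t k).1.2) (fun k ↦ (t k).2.2)
  rw [sum_sq_tensor t.1.1 (fun b ↦ ∑ j, t.2.1 j * h j b), mul_pow]
  refine mul_le_mul_of_nonneg_left ?_ (sq_nonneg σ)
  have h1 := (Real.sqrt_le_left hR0).1 (hR _ t.2.2)
  have h2 : ∑ a, t.1.1 a ^ 2 ≤ 1 := t.1.2
  have h3 : 0 ≤ ∑ b, (∑ j, t.2.1 j * h j b) ^ 2 := Finset.sum_nonneg fun _ _ ↦ sq_nonneg _
  exact (mul_le_of_le_one_left h3 h2).trans h1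

lemma integrable_maxCoord_coeffDual {ι κ : Type*} [Fintype ι] [Nonempty ι] [Fintype κ]
    (P : Measure (κ → ℝ)) [IsGaussian P] (c : ι → κ → ℝ) :
    Integrable (fun x ↦ maxCoord (fun k ↦ coeffDual (c k) x)) P :=
  (expGrowth_maxCoord.comp_clm (ContinuousLinearMap.pi fun k ↦ coeffDual (c k))).integrable P
    (continuous_maxCoord.comp
      (ContinuousLinearMap.pi fun k ↦ coeffDual (c k)).continuous).aestronglyMeasurable

lemma integral_maxCoord_le_frobenius {ι κ : Type*} [Fintype ι] [Nonempty ι] [Fintype κ]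
    (P : Measure (κ → ℝ)) [IsGaussian P] {σ : ℝ} (hσ : 0 ≤ σ)
    (hvar : ∀ c : κ → ℝ, ∫ x, (∑ p, c p * x p) ^ 2 ∂P ≤ σ ^ 2 * ∑ p, c p ^ 2)
    (c : ι → κ → ℝ) (hc : ∀ k, ∑ p, c k p ^ 2 ≤ 1) :
    ∫ x, maxCoord (fun k ↦ coeffDual (c k) x) ∂P ≤ σ * √(Fintype.card κ) := by
  classical
  set L : κ → StrongDual ℝ (κ → ℝ) := fun p ↦ coeffDual (Pi.single p 1)
  have hL : ∀ p x, L p x = x p := fun p x ↦ by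
    simp only [L, coeffDual_apply, Pi.single_apply, ite_mul, one_mul, zero_mul,
      Finset.sum_ite_eq', Finset.mem_univ, if_true]
  calc ∫ x, maxCoord (fun k ↦ coeffDual (c k) x) ∂P ≤ ∫ x, √(∑ p, L p x ^ 2) ∂P := by
        refine integral_mono (integrable_maxCoord_coeffDual P c) (integrable_sqrt_sum_sq P L)
          fun x ↦ maxCoord_le fun k ↦ ?_
        simp only [hL, coeffDual_apply]
        exact sum_mul_le_sqrt (hc k)
    _ ≤ √(∑ p, ∫ x, L p x ^ 2 ∂P) := integral_sqrt_sum_sq_le P L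
    _ ≤ √(∑ _p : κ, σ ^ 2) := by
        refine Real.sqrt_le_sqrt (Finset.sum_le_sum fun p _ ↦ ?_)
        simp only [L, coeffDual_apply]
        refine (hvar _).trans (le_of_eq ?_)
        simp [Pi.single_apply]
    _ = σ * √(Fintype.card κ) := by
        rw [Finset.sum_const, nsmul_eq_mul, mul_comm, Real.sqrt_mul (sq_nonneg σ),
          Real.sqrt_sq hσ, Finset.card_univ]

/-- Joint concentration of the Frobenius norm and of the bilinear forms of a Gaussian matrix. -/
theorem measure_exists_frobenius_add_bilin_lt_le (P : Measure (γ × β → ℝ)) [IsGaussian P]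
    (hP : ∀ L : StrongDual ℝ (γ × β → ℝ), ∫ x, L x ∂P = 0) {σ : ℝ} (hσ : 0 ≤ σ)
    (hvar : ∀ c : γ × β → ℝ, ∫ x, (∑ p, c p * x p) ^ 2 ∂P ≤ σ ^ 2 * ∑ p, c p ^ 2)
    {c r : ℝ} (hc : 0 ≤ c) (hr : 0 ≤ r) :
    P {x | ∃ t : euclBall (γ × β) × euclBall γ × euclBall β,
      σ * √(Fintype.card (γ × β)) + c * (σ * (√(Fintype.card γ) + √(Fintype.card β)))
        + σ * (1 + c) * r
        < coeffDual (fun p : γ × β ↦ t.1.1 p + c * (t.2.1.1 p.1 * t.2.2.1 p.2)) x}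
      ≤ ENNReal.ofReal (Real.exp (-r ^ 2 / 2)) := by
  classical
  refine measure_exists_lt_coeffDual_le P hP
    (a := fun (t : euclBall (γ × β) × euclBall γ × euclBall β) (p : γ × β) ↦
      t.1.1 p + c * (t.2.1.1 p.1 * t.2.2.1 p.2))
    (continuous_pi fun p ↦ (continuous_euclBall_apply continuous_fst p).add
      (continuous_const.mul
        ((continuous_euclBall_apply (continuous_fst.comp continuous_snd) p.1).mul
        (continuous_euclBall_apply (continuous_snd.comp continuous_snd) p.2)))) (by positivity) hr
    (fun t ↦ (hvar _).trans ?_) fun N t ↦ ?_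
  · rw [mul_pow]
    refine mul_le_mul_of_nonneg_left ?_ (sq_nonneg σ)
    have h1 : ∑ p, t.1.1 p ^ 2 ≤ 1 := t.1.2
    have h2 : ∑ p : γ × β, (t.2.1.1 p.1 * t.2.2.1 p.2) ^ 2 ≤ 1 := by
      rw [sum_sq_tensor t.2.1.1 t.2.2.1]
      exact mul_le_one₀ t.2.1.2 (Finset.sum_nonneg fun _ _ ↦ sq_nonneg _) t.2.2.2
    have h3 : ∑ p, t.1.1 p * (t.2.1.1 p.1 * t.2.2.1 p.2) ≤ 1 :=
      (sum_mul_le_sqrt h1).trans (Real.sqrt_le_one.2 h2)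
    have h4 : ∑ p, (t.1.1 p + c * (t.2.1.1 p.1 * t.2.2.1 p.2)) ^ 2
        = ∑ p, t.1.1 p ^ 2 + 2 * c * ∑ p, t.1.1 p * (t.2.1.1 p.1 * t.2.2.1 p.2)
          + c ^ 2 * ∑ p : γ × β, (t.2.1.1 p.1 * t.2.2.1 p.2) ^ 2 := by
      rw [Finset.mul_sum, Finset.mul_sum, ← Finset.sum_add_distrib, ← Finset.sum_add_distrib]
      exact Finset.sum_congr rfl fun p _ ↦ by ring
    rw [h4]
    nlinarith [mul_le_mul_of_nonneg_left h3 hc, mul_le_mul_of_nonneg_left h2 (sq_nonneg c)]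
  · have hF := integral_maxCoord_le_frobenius P hσ hvar (fun k ↦ (t k).1.1) fun k ↦ (t k).1.2
    have hI : ∀ (v : β → ℝ) (b : β), ∑ j, v j * (if j = b then (1 : ℝ) else 0) = v b := by simp
    have hB := integral_maxCoord_bilin_le P hP hσ hvar
      (fun j b : β ↦ if j = b then (1 : ℝ) else 0) (R := 1)
      (fun v hv ↦ by simpa only [hI, Real.sqrt_le_one] using hv)
      (fun k ↦ (t k).2.1.1) (fun k ↦ (t k).2.2.1) (fun k ↦ (t k).2.1.2) (fun k ↦ (t k).2.2.2)
    have hcard : ∑ j : β, ∑ b : β, (if j = b then (1 : ℝ) else 0) ^ 2 = Fintype.card β := by simp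
    simp only [hI, hcard, one_mul] at hB
    have i1 := integrable_maxCoord_coeffDual P (fun k ↦ (t k).1.1)
    have i2 := integrable_maxCoord_coeffDual P
      (fun k (p : γ × β) ↦ (t k).2.1.1 p.1 * (t k).2.2.1 p.2)
    calc _ ≤ ∫ x, (maxCoord (fun k ↦ coeffDual (t k).1.1 x) + c * maxCoord (fun k ↦
            coeffDual (fun p : γ × β ↦ (t k).2.1.1 p.1 * (t k).2.2.1 p.2) x)) ∂P := by
          refine integral_mono (integrable_maxCoord_coeffDual P _) (i1.add (i2.const_mul c))
            fun x ↦ maxCoord_le fun k ↦ ?_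
          have e : coeffDual (fun p : γ × β ↦
              (t k).1.1 p + c * ((t k).2.1.1 p.1 * (t k).2.2.1 p.2)) x
              = coeffDual (t k).1.1 x
                + c * coeffDual (fun p : γ × β ↦ (t k).2.1.1 p.1 * (t k).2.2.1 p.2) x := by
            simp only [coeffDual_apply]
            rw [Finset.mul_sum, ← Finset.sum_add_distrib]
            exact Finset.sum_congr rfl fun p _ ↦ by ring
          rw [e]
          exact add_le_add (le_maxCoord (fun k ↦ coeffDual (t k).1.1 x) k)
            (mul_le_mul_of_nonneg_left (le_maxCoord (fun k ↦ coeffDual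
              (fun p : γ × β ↦ (t k).2.1.1 p.1 * (t k).2.2.1 p.2) x) k) hc)
      _ ≤ _ := by
          rw [integral_add i1 (i2.const_mul c), integral_const_mul]
          exact add_le_add hF (mul_le_mul_of_nonneg_left hB hc)

end Events

section Product

variable {α β γ : Type*} [Fintype α] [Fintype β] [Fintype γ]

lemma exists_euclBall_sum_mul_eq {κ : Type*} [Fintype κ] (w : κ → ℝ) :
    ∃ u : euclBall κ, ∑ i, u.1 i * w i = √(∑ i, w i ^ 2) := by
  have h0 : 0 ≤ ∑ i, w i ^ 2 := Finset.sum_nonneg fun i _ ↦ sq_nonneg _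
  set R := √(∑ i, w i ^ 2) with hR
  have hsq : R ^ 2 = ∑ i, w i ^ 2 := Real.sq_sqrt h0
  refine ⟨⟨fun i ↦ R⁻¹ * w i, ?_⟩, ?_⟩
  · change ∑ i, (R⁻¹ * w i) ^ 2 ≤ 1
    simp only [mul_pow]
    rw [← Finset.mul_sum, ← hsq, ← mul_pow]
    rcases eq_or_ne R 0 with h | h <;> simp [h]
  · simp only [mul_assoc, ← sq]
    rw [← Finset.mul_sum, ← hsq]
    rcases eq_or_ne R 0 with h | h
    · simp [h]
    · field_simp

lemma exists_norm_bound_attained (c : ℝ) (y : γ × β → ℝ) :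
    ∃ R : ℝ, (∀ v : γ → ℝ, ∑ j, v j ^ 2 ≤ 1 → √(∑ b, (∑ j, v j * y (j, b)) ^ 2) ≤ R) ∧
      ∃ t : euclBall (γ × β) × euclBall γ × euclBall β,
        coeffDual (fun p : γ × β ↦ t.1.1 p + c * (t.2.1.1 p.1 * t.2.2.1 p.2)) y
          = √(∑ j, ∑ b, y (j, b) ^ 2) + c * R := by
  obtain ⟨v₀, hv₀, hmax⟩ := (isCompact_euclBall γ).exists_isMaxOn
    (Set.nonempty_coe_sort.1 inferInstance)
    (f := fun v : γ → ℝ ↦ √(∑ b, (∑ j, v j * y (j, b)) ^ 2)) (by fun_prop)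
  obtain ⟨u, hu⟩ := exists_euclBall_sum_mul_eq fun b ↦ ∑ j, v₀ j * y (j, b)
  obtain ⟨W, hW⟩ := exists_euclBall_sum_mul_eq y
  refine ⟨√(∑ b, (∑ j, v₀ j * y (j, b)) ^ 2), fun v hv ↦ hmax hv, ⟨W, ⟨v₀, hv₀⟩, u⟩, ?_⟩
  rw [← hu, ← Fintype.sum_prod_type (f := fun p ↦ y p ^ 2), ← hW]
  simp only [coeffDual_apply, add_mul, Finset.sum_add_distrib]
  congr 1
  rw [Fintype.sum_prod_type, Finset.sum_comm, Finset.mul_sum]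
  refine Finset.sum_congr rfl fun b _ ↦ ?_
  rw [Finset.mul_sum, Finset.mul_sum]
  exact Finset.sum_congr rfl fun j _ ↦ by ring

/-- Tail bound for the bilinear forms of the product of two independent Gaussian matrices. -/
theorem prod_measure_exists_bilin_lt_le (P : Measure (α × β → ℝ)) [IsGaussian P]
    (hP : ∀ L : StrongDual ℝ (α × β → ℝ), ∫ x, L x ∂P = 0)
    (Q : Measure (γ × β → ℝ)) [IsGaussian Q]
    (hQ : ∀ L : StrongDual ℝ (γ × β → ℝ), ∫ x, L x ∂Q = 0) {σ : ℝ} (hσ : 0 ≤ σ)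
    (hPvar : ∀ c : α × β → ℝ, ∫ x, (∑ p, c p * x p) ^ 2 ∂P ≤ σ ^ 2 * ∑ p, c p ^ 2)
    (hQvar : ∀ c : γ × β → ℝ, ∫ x, (∑ p, c p * x p) ^ 2 ∂Q ≤ σ ^ 2 * ∑ p, c p ^ 2)
    {r T : ℝ} (hr : 0 ≤ r)
    (hT : σ * (σ * √(Fintype.card (γ × β))
        + (√(Fintype.card α) + r) * (σ * (√(Fintype.card γ) + √(Fintype.card β)))
        + σ * (1 + (√(Fintype.card α) + r)) * r) ≤ T) :
    MeasurableSet {z : (α × β → ℝ) × (γ × β → ℝ) | ∃ t : euclBall α × euclBall γ,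
      T < coeffDual (fun p : α × β ↦ t.1.1 p.1 * ∑ j, t.2.1 j * z.2 (j, p.2)) z.1} ∧
    (P.prod Q) {z | ∃ t : euclBall α × euclBall γ,
      T < coeffDual (fun p : α × β ↦ t.1.1 p.1 * ∑ j, t.2.1 j * z.2 (j, p.2)) z.1}
      ≤ 2 * ENNReal.ofReal (Real.exp (-r ^ 2 / 2)) := by
  set e := ENNReal.ofReal (Real.exp (-r ^ 2 / 2)) with he
  set c := √(Fintype.card α) + r with hc
  set T' := σ * √(Fintype.card (γ × β)) + c * (σ * (√(Fintype.card γ) + √(Fintype.card β)))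
        + σ * (1 + c) * r with hT'
  set B : Set (γ × β → ℝ) := {y | ∃ t : euclBall (γ × β) × euclBall γ × euclBall β,
    T' < coeffDual (fun p : γ × β ↦ t.1.1 p + c * (t.2.1.1 p.1 * t.2.2.1 p.2)) y} with hB
  have hBo : IsOpen B := by
    rw [hB, Set.ofPred_exists]
    exact isOpen_iUnion fun t ↦ isOpen_lt continuous_const (ContinuousLinearMap.continuous _)
  have hBm : Q B ≤ e :=
    measure_exists_frobenius_add_bilin_lt_le Q hQ hσ hQvar (by positivity) hr
  set S : Set ((α × β → ℝ) × (γ × β → ℝ)) := {z | ∃ t : euclBall α × euclBall γ,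
      T < coeffDual (fun p : α × β ↦ t.1.1 p.1 * ∑ j, t.2.1 j * z.2 (j, p.2)) z.1} with hS
  have hSo : IsOpen S := by
    simp only [hS, coeffDual_apply, Set.ofPred_exists]
    exact isOpen_iUnion fun t ↦ isOpen_lt continuous_const (by fun_prop)
  refine ⟨hSo.measurableSet, ?_⟩
  rw [Measure.prod_apply_symm hSo.measurableSet]
  have hsec : ∀ y, P ((fun x ↦ (x, y)) ⁻¹' S) ≤ B.indicator 1 y + e := by
    intro y
    by_cases hy : y ∈ B
    · rw [Set.indicator_of_mem hy]
      exact prob_le_one.trans le_self_add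
    · rw [Set.indicator_of_notMem hy, zero_add]
      obtain ⟨R, hR, t, ht⟩ := exists_norm_bound_attained c y
      have hle : √(∑ j, ∑ b, y (j, b) ^ 2) + c * R ≤ T' := by
        rw [← ht]
        by_contra! h
        exact hy ⟨t, h⟩
      refine le_trans (measure_mono ?_)
        (measure_exists_bilin_lt_le P hP hσ hPvar (fun j b ↦ y (j, b)) hR hr)
      rintro x ⟨t, hx⟩
      refine ⟨t, lt_of_le_of_lt ?_ hx⟩
      refine le_trans (le_of_eq ?_) ((mul_le_mul_of_nonneg_left hle hσ).trans hT)
      rw [hc]; ring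
  calc ∫⁻ y, P ((fun x ↦ (x, y)) ⁻¹' S) ∂Q ≤ ∫⁻ y, (B.indicator 1 y + e) ∂Q :=
        lintegral_mono hsec
    _ = Q B + e := by
        rw [lintegral_add_right _ measurable_const, lintegral_indicator_one hBo.measurableSet]
        simp
    _ ≤ 2 * e := by rw [two_mul]; gcongr

end Product

section Laws

variable {Ω κ : Type*} [MeasurableSpace Ω] [Fintype κ] {μ : Measure Ω} {X : Ω → κ → ℝ}

lemma IsCenteredGaussianVec.aemeasurable (hX : IsCenteredGaussianVec μ X) : AEMeasurable X μ := by
  classical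
  refine aemeasurable_pi_iff.2 fun p ↦ ?_
  obtain ⟨v, hv⟩ := hX (Pi.single p 1)
  have h : AEMeasurable (fun ω ↦ ∑ i, (Pi.single p 1 : κ → ℝ) i * X ω i) μ :=
    AEMeasurable.of_map_ne_zero (by rw [hv]; exact IsProbabilityMeasure.ne_zero _)
  simpa only [Pi.single_apply, ite_mul, one_mul, zero_mul, Finset.sum_ite_eq', Finset.mem_univ,
    if_true] using h

lemma IsCenteredGaussianVec.exists_map_dual (hX : IsCenteredGaussianVec μ X)
    (L : StrongDual ℝ (κ → ℝ)) : ∃ v : NNReal, (μ.map X).map L = gaussianReal 0 v := by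
  classical
  obtain ⟨v, hv⟩ := hX fun i ↦ L (Pi.single i 1)
  refine ⟨v, ?_⟩
  rw [AEMeasurable.map_map_of_aemeasurable L.continuous.aemeasurable hX.aemeasurable, ← hv]
  congr 1; ext ω
  have : X ω = ∑ i, X ω i • (Pi.single i 1 : κ → ℝ) := by
    ext j; simp [Pi.single_apply]
  rw [Function.comp_apply]
  conv_lhs => rw [this]
  simp [mul_comm]

lemma IsCenteredGaussianVec.isGaussian (hX : IsCenteredGaussianVec μ X) :
    IsGaussian (μ.map X) :=
  isGaussian_of_map_eq_gaussianReal fun L ↦ ⟨0, hX.exists_map_dual L⟩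

lemma IsCenteredGaussianVec.integral_dual (hX : IsCenteredGaussianVec μ X)
    (L : StrongDual ℝ (κ → ℝ)) : ∫ x, L x ∂(μ.map X) = 0 := by
  obtain ⟨v, hv⟩ := hX.exists_map_dual L
  have h := integral_map (μ := μ.map X) L.continuous.aemeasurable
    (f := fun x : ℝ ↦ x) (by fun_prop)
  rw [← h, hv, integral_id_gaussianReal]

lemma IsCenteredGaussianVec.integral_sq_le (hX : IsCenteredGaussianVec μ X) {σ : ℝ}
    (hvar : ∀ u : κ → ℝ, ∑ p, u p ^ 2 = 1 → ∫ ω, (∑ p, u p * X ω p) ^ 2 ∂μ ≤ σ ^ 2)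
    (c : κ → ℝ) : ∫ x, (∑ p, c p * x p) ^ 2 ∂(μ.map X) ≤ σ ^ 2 * ∑ p, c p ^ 2 := by
  rw [integral_map hX.aemeasurable (Continuous.aestronglyMeasurable (by fun_prop))]
  have h0 : 0 ≤ ∑ p, c p ^ 2 := Finset.sum_nonneg fun i _ ↦ sq_nonneg _
  set R := √(∑ p, c p ^ 2)
  have hR : R ^ 2 = ∑ p, c p ^ 2 := Real.sq_sqrt h0
  rcases eq_or_ne R 0 with h | h
  · have hc : ∀ p, c p = 0 := fun p ↦ by
      rw [h, eq_comm, zero_pow two_ne_zero, Finset.sum_eq_zero_iff_of_nonneg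
        fun i _ ↦ sq_nonneg _] at hR
      simpa using hR p (Finset.mem_univ p)
    simp [hc]
  · have h1 := hvar (fun p ↦ R⁻¹ * c p) (by
      simp only [mul_pow]
      rw [← Finset.mul_sum, ← hR, ← mul_pow, inv_mul_cancel₀ h, one_pow])
    simp only [mul_assoc, ← Finset.mul_sum, mul_pow] at h1
    rw [integral_const_mul, inv_pow, inv_mul_le_iff₀ (by positivity), hR] at h1
    linarith

end Laws

lemma specNorm_le_of_bilin_le {m n : Type*} [Fintype m] [Fintype n] [DecidableEq n]
    (A : Matrix m n ℝ) {T : ℝ} (hT : 0 ≤ T)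
    (h : ∀ (u : euclBall m) (v : euclBall n), ∑ i, ∑ j, u.1 i * v.1 j * A i j ≤ T) :
    specNorm A ≤ T := by
  refine ContinuousLinearMap.opNorm_le_of_unit_norm hT fun x hx ↦ ?_
  obtain ⟨u, hu⟩ := exists_euclBall_sum_mul_eq (A *ᵥ x.ofLp)
  have hx' : x.ofLp ∈ euclBall n := by
    have := EuclideanSpace.norm_sq_eq x
    rw [hx, one_pow] at this
    simp only [Real.norm_eq_abs, sq_abs] at this
    exact this.symm.le
  have hn : ‖LinearMap.toContinuousLinearMap (Matrix.toEuclideanLin A) x‖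
      = √(∑ i, (A *ᵥ x.ofLp) i ^ 2) := by
    rw [EuclideanSpace.norm_eq]
    simp [Matrix.toLpLin_apply]
  rw [hn, ← hu]
  refine le_trans (le_of_eq ?_) (h u ⟨x.ofLp, hx'⟩)
  refine Finset.sum_congr rfl fun i _ ↦ ?_
  rw [Matrix.mulVec, dotProduct, Finset.mul_sum]
  exact Finset.sum_congr rfl fun j _ ↦ by ring

/-- **Gaussian product lemma, part (i).** For independent centered Gaussian matrices
`G ∈ ℝ^{d₁×n}`, `H ∈ ℝ^{d₂×n}` with all one-dimensional projections of variance at most `σ²`,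
with probability at least `1 − 2e^{−x²/2}`,
`‖G Hᵀ‖_S ≤ σ²(√(d₁d₂) + √(d₁n) + √(d₂n)) + σ² x (x + 2√n + √d₁ + √d₂)`. -/
theorem gaussian_product_opNorm_bound {Ω : Type*} [MeasurableSpace Ω] (μ : Measure Ω)
    [IsProbabilityMeasure μ] (d₁ d₂ n : ℕ) (σ : ℝ) (hσ : 0 < σ)
    (G : Ω → Matrix (Fin d₁) (Fin n) ℝ) (H : Ω → Matrix (Fin d₂) (Fin n) ℝ)
    (hGgauss : IsCenteredGaussianVec μ (fun ω (p : Fin d₁ × Fin n) => G ω p.1 p.2))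
    (hHgauss : IsCenteredGaussianVec μ (fun ω (p : Fin d₂ × Fin n) => H ω p.1 p.2))
    (hindep : IndepFun (fun ω (p : Fin d₁ × Fin n) => G ω p.1 p.2)
      (fun ω (p : Fin d₂ × Fin n) => H ω p.1 p.2) μ)
    (hGvar : ∀ u : Fin d₁ × Fin n → ℝ, ∑ p, (u p) ^ 2 = 1 →
      ∫ ω, (∑ p, u p * G ω p.1 p.2) ^ 2 ∂μ ≤ σ ^ 2)
    (hHvar : ∀ v : Fin d₂ × Fin n → ℝ, ∑ p, (v p) ^ 2 = 1 →
      ∫ ω, (∑ p, v p * H ω p.1 p.2) ^ 2 ∂μ ≤ σ ^ 2) :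
    ∀ x : ℝ, 0 ≤ x →
      ENNReal.ofReal (1 - 2 * Real.exp (-x ^ 2 / 2)) ≤
        μ {ω | specNorm (G ω * (H ω)ᵀ) ≤
          σ ^ 2 * (Real.sqrt ((d₁ : ℝ) * d₂) + Real.sqrt ((d₁ : ℝ) * n) +
            Real.sqrt ((d₂ : ℝ) * n)) +
          σ ^ 2 * x * (x + 2 * Real.sqrt (n : ℝ) + Real.sqrt (d₁ : ℝ) +
            Real.sqrt (d₂ : ℝ))} := by
  intro x hx
  set T := σ ^ 2 * (√((d₁ : ℝ) * d₂) + √((d₁ : ℝ) * n) + √((d₂ : ℝ) * n)) +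
    σ ^ 2 * x * (x + 2 * √(n : ℝ) + √(d₁ : ℝ) + √(d₂ : ℝ)) with hTdef
  have hT0 : 0 ≤ T := by positivity
  rcases Nat.eq_zero_or_pos n with hn | hn
  · subst hn
    have hzero : ∀ ω, specNorm (G ω * (H ω)ᵀ) ≤ T := fun ω ↦
      specNorm_le_of_bilin_le _ hT0 fun u v ↦ by simpa [Matrix.mul_apply] using hT0
    simp only [hzero, Set.ofPred_true, measure_univ]
    exact ENNReal.ofReal_le_one.2 (by linarith [Real.exp_pos (-x ^ 2 / 2)])
  set X : Ω → Fin d₁ × Fin n → ℝ := fun ω p ↦ G ω p.1 p.2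
  set Y : Ω → Fin d₂ × Fin n → ℝ := fun ω p ↦ H ω p.1 p.2
  have hX : AEMeasurable X μ := hGgauss.aemeasurable
  have hY : AEMeasurable Y μ := hHgauss.aemeasurable
  have : IsGaussian (μ.map X) := hGgauss.isGaussian
  have : IsGaussian (μ.map Y) := hHgauss.isGaussian
  have hTle : σ * (σ * √(Fintype.card (Fin d₂ × Fin n))
      + (√(Fintype.card (Fin d₁)) + x) * (σ * (√(Fintype.card (Fin d₂)) + √(Fintype.card (Fin n))))
      + σ * (1 + (√(Fintype.card (Fin d₁)) + x)) * x) ≤ T := by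
    have h1 : 1 ≤ √(n : ℝ) := Real.one_le_sqrt.2 (by exact_mod_cast hn)
    rw [hTdef]
    simp only [Fintype.card_prod, Fintype.card_fin, Nat.cast_mul, Real.sqrt_mul (Nat.cast_nonneg _)]
    have : 0 ≤ σ ^ 2 * x * (√(n : ℝ) - 1) :=
      mul_nonneg (by positivity) (sub_nonneg.2 h1)
    linarith
  obtain ⟨hS, hSle⟩ := prod_measure_exists_bilin_lt_le (μ.map X) hGgauss.integral_dual (μ.map Y)
    hHgauss.integral_dual hσ.le (hGgauss.integral_sq_le hGvar) (hHgauss.integral_sq_le hHvar)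
    hx hTle
  rw [← (indepFun_iff_map_prod_eq_prod_map_map hX hY).1 hindep,
    Measure.map_apply_of_aemeasurable (hX.prodMk hY) hS] at hSle
  have hcompl : μ {ω | specNorm (G ω * (H ω)ᵀ) ≤ T}ᶜ
      ≤ 2 * ENNReal.ofReal (Real.exp (-x ^ 2 / 2)) := by
    refine (measure_mono fun ω hω ↦ ?_).trans hSle
    by_contra hcon
    refine hω (specNorm_le_of_bilin_le _ hT0 fun u v ↦ ?_)
    by_contra! hlt
    refine hcon ⟨(u, v), hlt.trans_eq ?_⟩
    rw [coeffDual_apply, Fintype.sum_prod_type]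
    refine Finset.sum_congr rfl fun i _ ↦ ?_
    simp only [Matrix.mul_apply, Matrix.transpose_apply, Finset.mul_sum, Finset.sum_mul]
    rw [Finset.sum_comm]
    exact Finset.sum_congr rfl fun k _ ↦ Finset.sum_congr rfl fun j _ ↦ by
      simp only [X, Y]; ring
  have htotal := (measure_univ (μ := μ)).symm.le.trans
    ((measure_univ_le_add_compl {ω | specNorm (G ω * (H ω)ᵀ) ≤ T}).trans
      (add_le_add_right hcompl _))
  rw [ENNReal.ofReal_sub _ (by positivity), ENNReal.ofReal_one,
    ENNReal.ofReal_mul zero_le_two, ENNReal.ofReal_ofNat]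
  exact tsub_le_iff_right.2 htotal
end

section
/- Let B₁, …, B_T be real d₁ × d₂ matrices, let M be a real d₂ × d₂ matrix, and let h be an integer with 1 ≤ h < T. Then ‖Σ_{t=h+1}^T B_{t−h} M B_tᵀ‖_S ≤ ‖M‖_S · ‖Σ_{t=1}^T B_t B_tᵀ‖_S. -/
open Matrix Finset

open scoped InnerProductSpace in
lemma inner_toEuclideanLin_eq_transpose_left {m n : Type*} [Fintype m] [Fintype n]
    [DecidableEq m] [DecidableEq n] (A : Matrix m n ℝ) (x : EuclideanSpace ℝ n)
    (y : EuclideanSpace ℝ m) :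
    ⟪y, Matrix.toEuclideanLin A x⟫_ℝ = ⟪Matrix.toEuclideanLin Aᵀ y, x⟫_ℝ := by
  rw [← conjTranspose_eq_transpose_of_trivial, Matrix.toEuclideanLin_conjTranspose_eq_adjoint,
    LinearMap.adjoint_inner_left]

lemma toEuclideanLin_mul_apply {l m n : Type*} [Fintype m] [Fintype n]
    [DecidableEq m] [DecidableEq n] (A : Matrix l m ℝ) (B : Matrix m n ℝ)
    (x : EuclideanSpace ℝ n) :
    Matrix.toEuclideanLin (A * B) x = Matrix.toEuclideanLin A (Matrix.toEuclideanLin B x) := by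
  simp [Matrix.toLpLin_apply, Matrix.mulVec_mulVec]

lemma specNorm_nonneg {m n : Type*} [Fintype m] [Fintype n] [DecidableEq n]
    (A : Matrix m n ℝ) : 0 ≤ specNorm A :=
  norm_nonneg _

lemma norm_toEuclideanLin_le_specNorm {m n : Type*} [Fintype m] [Fintype n] [DecidableEq n]
    (A : Matrix m n ℝ) (x : EuclideanSpace ℝ n) :
    ‖Matrix.toEuclideanLin A x‖ ≤ specNorm A * ‖x‖ :=
  (LinearMap.toContinuousLinearMap (Matrix.toEuclideanLin A)).le_opNorm x

open scoped InnerProductSpace in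
/-- A bound on the bilinear form of a matrix bounds its spectral norm. -/
lemma specNorm_le_of_inner_le {m n : Type*} [Fintype m] [Fintype n] [DecidableEq n]
    {A : Matrix m n ℝ} {C : ℝ} (hC : 0 ≤ C)
    (h : ∀ x y, ⟪y, Matrix.toEuclideanLin A x⟫_ℝ ≤ C * (‖y‖ * ‖x‖)) : specNorm A ≤ C := by
  refine ContinuousLinearMap.opNorm_le_bound _ hC fun x => ?_
  rw [LinearMap.coe_toContinuousLinearMap']
  rcases (norm_nonneg (Matrix.toEuclideanLin A x)).eq_or_lt with h0 | h0
  · rw [← h0]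
    positivity
  · have key := h x (Matrix.toEuclideanLin A x)
    rw [real_inner_self_eq_norm_mul_norm] at key
    exact le_of_mul_le_mul_left (by linarith) h0

lemma sum_sq_norm_transpose_le {ι m n : Type*} [Fintype m] [Fintype n]
    [DecidableEq m] [DecidableEq n] (s : Finset ι) (B : ι → Matrix m n ℝ)
    (x : EuclideanSpace ℝ m) :
    ∑ t ∈ s, ‖Matrix.toEuclideanLin (B t)ᵀ x‖ ^ 2 ≤
      specNorm (∑ t ∈ s, B t * (B t)ᵀ) * ‖x‖ ^ 2 := by
  calc ∑ t ∈ s, ‖Matrix.toEuclideanLin (B t)ᵀ x‖ ^ 2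
      = inner ℝ x (Matrix.toEuclideanLin (∑ t ∈ s, B t * (B t)ᵀ) x) := by
        rw [map_sum, LinearMap.sum_apply, inner_sum]
        refine Finset.sum_congr rfl fun t _ => ?_
        rw [toEuclideanLin_mul_apply, inner_toEuclideanLin_eq_transpose_left,
          real_inner_self_eq_norm_sq]
    _ ≤ ‖x‖ * ‖Matrix.toEuclideanLin (∑ t ∈ s, B t * (B t)ᵀ) x‖ := real_inner_le_norm _ _
    _ ≤ ‖x‖ * (specNorm (∑ t ∈ s, B t * (B t)ᵀ) * ‖x‖) := by
        gcongr
        exact norm_toEuclideanLin_le_specNorm _ _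
    _ = specNorm (∑ t ∈ s, B t * (B t)ᵀ) * ‖x‖ ^ 2 := by ring

/-- **Lagged sum factorization bound (Step 4 of the iTIPUP proof).** For matrices
`B₁,…,B_T ∈ ℝ^{d₁×d₂}`, a matrix `M ∈ ℝ^{d₂×d₂}` and a lag `1 ≤ h < T`,
`‖Σ_{t=h+1}^T B_{t−h} M B_tᵀ‖_S ≤ ‖M‖_S · ‖Σ_{t=1}^T B_t B_tᵀ‖_S`. -/
theorem lagged_sum_specNorm_bound (d₁ d₂ T h : ℕ) (hh : 1 ≤ h) (hT : h < T)
    (B : ℕ → Matrix (Fin d₁) (Fin d₂) ℝ) (M : Matrix (Fin d₂) (Fin d₂) ℝ) :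
    specNorm (∑ t ∈ Icc (h + 1) T, B (t - h) * M * (B t)ᵀ) ≤
      specNorm M * specNorm (∑ t ∈ Icc 1 T, B t * (B t)ᵀ) := by
  set S := specNorm (∑ t ∈ Icc 1 T, B t * (B t)ᵀ) with hS
  have hS0 : 0 ≤ S := specNorm_nonneg _
  have hM0 : 0 ≤ specNorm M := specNorm_nonneg _
  refine specNorm_le_of_inner_le (mul_nonneg hM0 hS0) fun x y => ?_
  have hx : ∑ t ∈ Icc (h + 1) T, ‖Matrix.toEuclideanLin (B t)ᵀ x‖ ^ 2 ≤ S * ‖x‖ ^ 2 :=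
    (Finset.sum_le_sum_of_subset_of_nonneg (Finset.Icc_subset_Icc_left (by omega))
      fun _ _ _ => by positivity).trans (sum_sq_norm_transpose_le _ B x)
  have hy : ∑ t ∈ Icc (h + 1) T, ‖Matrix.toEuclideanLin (B (t - h))ᵀ y‖ ^ 2 ≤ S * ‖y‖ ^ 2 := by
    have hinj : Set.InjOn (fun t => t - h) (Icc (h + 1) T : Finset ℕ) := by
      intro a ha b hb hab
      simp only [coe_Icc, Set.mem_Icc] at ha hb hab
      omega
    have hsub : (Icc (h + 1) T).image (fun t => t - h) ⊆ Icc 1 T := by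
      intro a ha
      simp only [mem_image, mem_Icc] at ha ⊢
      omega
    rw [← Finset.sum_image (f := fun t => ‖Matrix.toEuclideanLin (B t)ᵀ y‖ ^ 2) hinj]
    exact (Finset.sum_le_sum_of_subset_of_nonneg hsub
      fun _ _ _ => by positivity).trans (sum_sq_norm_transpose_le _ B y)
  calc inner ℝ y (Matrix.toEuclideanLin (∑ t ∈ Icc (h + 1) T, B (t - h) * M * (B t)ᵀ) x)
      = ∑ t ∈ Icc (h + 1) T, inner ℝ (Matrix.toEuclideanLin (B (t - h))ᵀ y)
          (Matrix.toEuclideanLin M (Matrix.toEuclideanLin (B t)ᵀ x)) := by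
        rw [map_sum, LinearMap.sum_apply, inner_sum]
        refine Finset.sum_congr rfl fun t _ => ?_
        rw [toEuclideanLin_mul_apply, toEuclideanLin_mul_apply,
          inner_toEuclideanLin_eq_transpose_left]
    _ ≤ ∑ t ∈ Icc (h + 1) T, specNorm M *
          (‖Matrix.toEuclideanLin (B (t - h))ᵀ y‖ * ‖Matrix.toEuclideanLin (B t)ᵀ x‖) := by
        refine Finset.sum_le_sum fun t _ => (real_inner_le_norm _ _).trans ?_
        rw [mul_left_comm]
        gcongr
        exact norm_toEuclideanLin_le_specNorm _ _
    _ ≤ specNorm M * (√(S * ‖y‖ ^ 2) * √(S * ‖x‖ ^ 2)) := by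
        rw [← Finset.mul_sum]
        gcongr
        refine (Real.sum_mul_le_sqrt_mul_sqrt _ _ _).trans ?_
        gcongr
    _ = specNorm M * S * (‖y‖ * ‖x‖) := by
        rw [Real.sqrt_mul hS0, Real.sqrt_mul hS0, Real.sqrt_sq (norm_nonneg _),
          Real.sqrt_sq (norm_nonneg _), mul_mul_mul_comm, Real.mul_self_sqrt hS0, mul_assoc]
end

section
/- Let v₁, …, v_T be vectors in ℝ^d and let h be an integer with 1 ≤ h < T. Then the lagged sum of outer products satisfies ‖Σ_{t=h+1}^T v_{t−h} v_tᵀ‖_F ≤ ‖Σ_{t=1}^T v_t v_tᵀ‖_F. -/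
open Matrix Finset

/-- Frobenius norm of a real matrix. -/
noncomputable def frobNorm {m n : Type*} [Fintype m] [Fintype n] (A : Matrix m n ℝ) : ℝ :=
  Real.sqrt (∑ i, ∑ j, (A i j) ^ 2)

/-- The squared Frobenius norm of a sum of outer products, in terms of the two Gram matrices. -/
theorem sum_sq_sum_vecMulVec {ι m n : Type*} [Fintype m] [Fintype n] (s : Finset ι)
    (u : ι → m → ℝ) (w : ι → n → ℝ) :
    ∑ i, ∑ j, ((∑ t ∈ s, vecMulVec (u t) (w t)) i j) ^ 2 =
      ∑ p ∈ s ×ˢ s, (u p.1 ⬝ᵥ u p.2) * (w p.1 ⬝ᵥ w p.2) := by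
  simp only [Matrix.sum_apply, vecMulVec_apply, sq, dotProduct, sum_mul_sum, sum_product]
  simp_rw [sum_comm (s := univ) (t := s)]
  refine sum_congr rfl fun _ _ => sum_congr rfl fun _ _ =>
    sum_congr rfl fun _ _ => sum_congr rfl fun _ _ => ?_
  ring

/-- **Cauchy–Schwarz bound for lagged outer products (Remark 3 of the paper).** For vectors
`v₁,…,v_T ∈ ℝ^d` and a lag `1 ≤ h < T`,
`‖Σ_{t=h+1}^T v_{t−h} v_tᵀ‖_F ≤ ‖Σ_{t=1}^T v_t v_tᵀ‖_F`. -/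
theorem lagged_outer_product_frobNorm_le (d T h : ℕ) (hh : 1 ≤ h) (hT : h < T)
    (v : ℕ → Fin d → ℝ) :
    frobNorm (∑ t ∈ Icc (h + 1) T, vecMulVec (v (t - h)) (v t)) ≤
      frobNorm (∑ t ∈ Icc 1 T, vecMulVec (v t) (v t)) := by
  set I := Icc (h + 1) T
  set J := Icc 1 T
  set G : ℕ × ℕ → ℝ := fun p => v p.1 ⬝ᵥ v p.2
  set shift : ℕ × ℕ → ℕ × ℕ := fun p => (p.1 - h, p.2 - h)
  have hIJ : I ×ˢ I ⊆ J ×ˢ J := by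
    intro p
    simp only [I, J, mem_product, mem_Icc]
    omega
  have hshift : (I ×ˢ I).image shift ⊆ J ×ˢ J := by
    intro p
    simp only [I, J, shift, mem_image, mem_product, mem_Icc]
    rintro ⟨q, hq, rfl⟩
    dsimp only
    omega
  have hinj : Set.InjOn shift (I ×ˢ I : Finset (ℕ × ℕ)) := by
    rintro ⟨a, b⟩ hp ⟨c, e⟩ hq hpq
    simp only [I, shift, mem_coe, mem_product, mem_Icc, Prod.mk.injEq] at hp hq hpq ⊢
    omega
  have hG : ∑ p ∈ I ×ˢ I, G p ^ 2 ≤ ∑ p ∈ J ×ˢ J, G p ^ 2 :=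
    sum_le_sum_of_subset_of_nonneg hIJ fun _ _ _ => sq_nonneg _
  have hG_shift : ∑ p ∈ I ×ˢ I, G (shift p) ^ 2 ≤ ∑ p ∈ J ×ˢ J, G p ^ 2 := by
    rw [← sum_image (f := fun p => G p ^ 2) hinj]
    exact sum_le_sum_of_subset_of_nonneg hshift fun _ _ _ => sq_nonneg _
  have hmul : 2 * ∑ p ∈ I ×ˢ I, G (shift p) * G p ≤
      ∑ p ∈ I ×ˢ I, G (shift p) ^ 2 + ∑ p ∈ I ×ˢ I, G p ^ 2 := by
    rw [mul_sum, ← sum_add_distrib]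
    refine sum_le_sum fun p _ => ?_
    rw [← mul_assoc]
    exact two_mul_le_add_sq _ _
  refine Real.sqrt_le_sqrt ?_
  rw [sum_sq_sum_vecMulVec I (fun t => v (t - h)) v, sum_sq_sum_vecMulVec J v v]
  calc ∑ p ∈ I ×ˢ I, G (shift p) * G p ≤ ∑ p ∈ J ×ˢ J, G p ^ 2 := by linarith
    _ = ∑ p ∈ J ×ˢ J, G p * G p := by simp only [sq]
end

section
/- Let B₁, …, B_T be real d₁ × m matrices and let h₀ be an integer with 1 ≤ h₀ < T. For 1 ≤ h ≤ h₀ define Θ*_h = (T − h)⁻¹ Σ_{t=h+1}^T B_{t−h} B_tᵀ, and define Θ*₀ = T⁻¹ Σ_{t=1}^T B_t B_tᵀ. Then the d₁ × (d₁ h₀) horizontally concatenated matrix [Θ*₁, Θ*₂, …, Θ*_{h₀}] satisfies ‖[Θ*₁, …, Θ*_{h₀}]‖_S ≤ √h₀ · ‖Θ*₀‖_S / (1 − h₀/T). -/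
open Matrix Finset

/-- The normalized lag-`h` Gram matrix `Θ*_h = (T − h)⁻¹ Σ_{t=h+1}^T B_{t−h} B_tᵀ`
(for `h = 0` this is `Θ*₀ = T⁻¹ Σ_{t=1}^T B_t B_tᵀ`). -/
noncomputable def laggedGram (d₁ m : ℕ) (B : ℕ → Matrix (Fin d₁) (Fin m) ℝ) (T h : ℕ) :
    Matrix (Fin d₁) (Fin d₁) ℝ :=
  ((T : ℝ) - h)⁻¹ • ∑ t ∈ Icc (h + 1) T, B (t - h) * (B t)ᵀ

lemma inner_toEuclideanLin_mul_transpose {l m n : Type*} [Fintype l] [Fintype m] [Fintype n]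
    [DecidableEq l] [DecidableEq n]
    (C : Matrix l m ℝ) (D : Matrix n m ℝ) (u : EuclideanSpace ℝ l) (v : EuclideanSpace ℝ n) :
    inner ℝ u (Matrix.toEuclideanLin (C * Dᵀ) v) =
      inner ℝ (Matrix.toEuclideanLin Cᵀ u) (Matrix.toEuclideanLin Dᵀ v) := by
  simp only [EuclideanSpace.inner_eq_star_dotProduct, star_trivial, Matrix.ofLp_toLpLin,
    Matrix.toLin'_apply]
  rw [← Matrix.mulVec_mulVec, Matrix.mulVec_transpose C, dotProduct_comm,
    Matrix.dotProduct_mulVec, dotProduct_comm]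

lemma inner_toEuclideanLin_laggedGram (d₁ m : ℕ) (B : ℕ → Matrix (Fin d₁) (Fin m) ℝ) (T h : ℕ)
    (u v : EuclideanSpace ℝ (Fin d₁)) :
    inner ℝ u (Matrix.toEuclideanLin (laggedGram d₁ m B T h) v) =
      ((T : ℝ) - h)⁻¹ * ∑ t ∈ Icc (h + 1) T,
        inner ℝ (Matrix.toEuclideanLin (B (t - h))ᵀ u) (Matrix.toEuclideanLin (B t)ᵀ v) := by
  simp only [laggedGram, map_smul, map_sum, LinearMap.smul_apply, LinearMap.sum_apply,
    inner_smul_right, inner_sum, inner_toEuclideanLin_mul_transpose]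

lemma sum_norm_sq_toEuclideanLin_transpose_le (d₁ m : ℕ) (B : ℕ → Matrix (Fin d₁) (Fin m) ℝ)
    (T : ℕ) (u : EuclideanSpace ℝ (Fin d₁)) :
    ∑ t ∈ Icc 1 T, ‖Matrix.toEuclideanLin (B t)ᵀ u‖ ^ 2 ≤
      T * specNorm (laggedGram d₁ m B T 0) * ‖u‖ ^ 2 := by
  rcases Nat.eq_zero_or_pos T with rfl | hT
  · simp
  have hT' : (0 : ℝ) < T := by exact_mod_cast hT
  have h := inner_toEuclideanLin_laggedGram d₁ m B T 0 u u
  simp only [Nat.cast_zero, sub_zero, zero_add, Nat.sub_zero, real_inner_self_eq_norm_sq] at h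
  rw [← div_eq_inv_mul, eq_div_iff hT'.ne'] at h
  have h₁ := (real_inner_le_norm u _).trans <| mul_le_mul_of_nonneg_left
    (norm_toEuclideanLin_le_specNorm (laggedGram d₁ m B T 0) u) (norm_nonneg u)
  rw [← h]
  nlinarith [mul_le_mul_of_nonneg_right h₁ hT'.le]

lemma norm_toEuclideanLin_laggedGram_le (d₁ m : ℕ) (B : ℕ → Matrix (Fin d₁) (Fin m) ℝ)
    {T h : ℕ} (hT : h < T) (v : EuclideanSpace ℝ (Fin d₁)) :
    ‖Matrix.toEuclideanLin (laggedGram d₁ m B T h) v‖ ≤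
      specNorm (laggedGram d₁ m B T 0) / (1 - (h : ℝ) / T) * ‖v‖ := by
  have hT' : (0 : ℝ) < T := by exact_mod_cast Nat.zero_lt_of_lt hT
  have hTh : (0 : ℝ) < (T : ℝ) - h := sub_pos.2 (by exact_mod_cast hT)
  have hs := specNorm_nonneg (laggedGram d₁ m B T 0)
  set s := specNorm (laggedGram d₁ m B T 0)
  have key : ∀ u : EuclideanSpace ℝ (Fin d₁),
      inner ℝ u (Matrix.toEuclideanLin (laggedGram d₁ m B T h) v) ≤
        ‖u‖ * (s / (1 - (h : ℝ) / T) * ‖v‖) := by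
    intro u
    have hu : ∑ t ∈ Icc (h + 1) T, ‖Matrix.toEuclideanLin (B (t - h))ᵀ u‖ ^ 2 ≤
        T * s * ‖u‖ ^ 2 := by
      refine le_trans ?_ (sum_norm_sq_toEuclideanLin_transpose_le d₁ m B T u)
      rw [← Finset.sum_image (s := Icc (h + 1) T) (g := fun t => t - h)
        (f := fun t => ‖Matrix.toEuclideanLin (B t)ᵀ u‖ ^ 2)]
      · refine Finset.sum_le_sum_of_subset_of_nonneg ?_ fun _ _ _ => sq_nonneg _
        intro t ht
        simp only [Finset.mem_image, Finset.mem_Icc] at ht ⊢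
        omega
      · intro a ha b hb hab
        simp only [Finset.coe_Icc, Set.mem_Icc] at ha hb hab
        omega
    have hv : ∑ t ∈ Icc (h + 1) T, ‖Matrix.toEuclideanLin (B t)ᵀ v‖ ^ 2 ≤
        T * s * ‖v‖ ^ 2 :=
      (Finset.sum_le_sum_of_subset_of_nonneg (Finset.Icc_subset_Icc_left (by omega))
        fun _ _ _ => sq_nonneg _).trans (sum_norm_sq_toEuclideanLin_transpose_le d₁ m B T v)
    have hsum : ∑ t ∈ Icc (h + 1) T, inner ℝ (Matrix.toEuclideanLin (B (t - h))ᵀ u)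
        (Matrix.toEuclideanLin (B t)ᵀ v) ≤ T * s * (‖u‖ * ‖v‖) :=
      calc _ ≤ ∑ t ∈ Icc (h + 1) T, ‖Matrix.toEuclideanLin (B (t - h))ᵀ u‖ *
              ‖Matrix.toEuclideanLin (B t)ᵀ v‖ :=
            Finset.sum_le_sum fun _ _ => real_inner_le_norm _ _
        _ ≤ _ := Real.sum_mul_le_sqrt_mul_sqrt _ _ _
        _ ≤ √(T * s * ‖u‖ ^ 2) * √(T * s * ‖v‖ ^ 2) := by gcongr
        _ = T * s * (‖u‖ * ‖v‖) := by
            rw [Real.sqrt_mul (x := T * s) (by positivity),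
              Real.sqrt_mul (x := T * s) (by positivity),
              Real.sqrt_sq (norm_nonneg _), Real.sqrt_sq (norm_nonneg _), mul_mul_mul_comm,
              Real.mul_self_sqrt (by positivity)]
    rw [inner_toEuclideanLin_laggedGram]
    calc _ ≤ ((T : ℝ) - h)⁻¹ * (T * s * (‖u‖ * ‖v‖)) := by gcongr
      _ = _ := by
        rw [one_sub_div hT'.ne']
        field_simp
  set w := Matrix.toEuclideanLin (laggedGram d₁ m B T h) v
  rcases (norm_nonneg w).eq_or_lt with hw | hw
  · rw [← hw, one_sub_div hT'.ne']
    positivity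
  · have := key w
    rw [real_inner_self_eq_norm_mul_norm] at this
    exact le_of_mul_le_mul_left this hw

/-- Block row matrices with uniformly bounded blocks: `‖[A₁, …, A_k]‖_S ≤ √k · c`. -/
lemma specNorm_blockRow_le {ι m n : Type*} [Fintype ι] [Fintype m] [Fintype n]
    [DecidableEq ι] [DecidableEq n] (A : ι → Matrix m n ℝ) {c : ℝ} (hc : 0 ≤ c)
    (hA : ∀ k x, ‖Matrix.toEuclideanLin (A k) x‖ ≤ c * ‖x‖) :
    specNorm (Matrix.of fun (i : m) (p : ι × n) => A p.1 i p.2) ≤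
      Real.sqrt (Fintype.card ι) * c := by
  refine ContinuousLinearMap.opNorm_le_bound _ (by positivity) fun x => ?_
  let y : ι → EuclideanSpace ℝ n := fun k => WithLp.toLp 2 fun j => x (k, j)
  have hx : ‖x‖ ^ 2 = ∑ k, ‖y k‖ ^ 2 := by
    simp [EuclideanSpace.norm_sq_eq, Fintype.sum_prod_type, y]
  have hmul : LinearMap.toContinuousLinearMap (Matrix.toEuclideanLin
      (Matrix.of fun (i : m) (p : ι × n) => A p.1 i p.2)) x =
        ∑ k, Matrix.toEuclideanLin (A k) (y k) := by
    ext i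
    simp [Matrix.mulVec, dotProduct, Fintype.sum_prod_type, y]
  have hy : ∑ k, ‖y k‖ ≤ √(Fintype.card ι) * ‖x‖ := by
    have := Real.sum_mul_le_sqrt_mul_sqrt Finset.univ (fun _ : ι => (1 : ℝ)) fun k => ‖y k‖
    simpa [← hx] using this
  rw [hmul]
  calc _ ≤ ∑ k, c * ‖y k‖ := norm_sum_le_of_le _ fun k _ => hA k (y k)
    _ = c * ∑ k, ‖y k‖ := (Finset.mul_sum _ _ _).symm
    _ ≤ c * (√(Fintype.card ι) * ‖x‖) := by gcongr
    _ = _ := by ring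

/-- **Spectral bound for the concatenated TIPUP matrix.** For matrices `B₁,…,B_T ∈ ℝ^{d₁×m}`
and `1 ≤ h₀ < T`, the horizontally concatenated matrix `[Θ*₁, …, Θ*_{h₀}]` satisfies
`‖[Θ*₁, …, Θ*_{h₀}]‖_S ≤ √h₀ · ‖Θ*₀‖_S / (1 − h₀/T)`. -/
theorem tipup_concat_specNorm_bound (d₁ m T h₀ : ℕ) (hh : 1 ≤ h₀) (hT : h₀ < T)
    (B : ℕ → Matrix (Fin d₁) (Fin m) ℝ) :
    specNorm (Matrix.of fun (i : Fin d₁) (p : Fin h₀ × Fin d₁) =>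
        laggedGram d₁ m B T ((p.1 : ℕ) + 1) i p.2) ≤
      Real.sqrt (h₀ : ℝ) * specNorm (laggedGram d₁ m B T 0) / (1 - (h₀ : ℝ) / T) := by
  have hT' : (0 : ℝ) < T := by exact_mod_cast Nat.zero_lt_of_lt hT
  have hpos : 0 < 1 - (h₀ : ℝ) / T := by
    rw [sub_pos, div_lt_one hT']
    exact_mod_cast hT
  have hs := specNorm_nonneg (laggedGram d₁ m B T 0)
  have := specNorm_blockRow_le (fun k : Fin h₀ => laggedGram d₁ m B T ((k : ℕ) + 1))
    (div_nonneg hs hpos.le) fun k x => by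
      refine (norm_toEuclideanLin_laggedGram_le d₁ m B (by omega) x).trans ?_
      have hk : (((k : ℕ) + 1 : ℕ) : ℝ) ≤ h₀ := by exact_mod_cast k.isLt
      gcongr
  rwa [Fintype.card_fin, ← mul_div_assoc] at this
end
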